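/- Assume Condition (D) and suppose π is a probability measure on X that is invariant for every kernel P_k (k ≥ 1) and satisfies π(V) < ∞. Let Ψ_1, Ψ_2 be a pair of Young functions and let f : X → ℝ be measurable with ‖f‖_W < ∞, where W(x) = Ψ_2(φ(V(x))/φ(1)). Then for all x ∈ X, Σ_{n=0}^∞ Ψ_1(r(n)) |P^(n) f(x) − π(f)| ≤ c · (V(x) + π(V) − 1) · ‖f‖_W, where c is the explicit constant c = (2/(ε_b φ(1)))[2 + b̄/ε_ν + c_* b̄ r(1)(1 + r(1)/(ε_b φ(1)))]. -/

import Mathlib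

open MeasureTheory ProbabilityTheory Filter Set

noncomputable def iterKernel {X : Type*} [MeasurableSpace X]
    (P : ℕ → Kernel X X) : ℕ → Kernel X X
  | 0 => Kernel.id
  | n + 1 => (P (n + 1)).comp (iterKernel P n)

noncomputable def Hfun (φ : ℝ → ℝ) (t : ℝ) : ℝ := ∫ s in (1:ℝ)..t, (φ s)⁻¹

noncomputable def Hinv (φ : ℝ → ℝ) : ℝ → ℝ := Function.invFunOn (Hfun φ) (Set.Ici 1)

noncomputable def rate (φ : ℝ → ℝ) (εb : ℝ) (n : ℕ) : ℝ := φ (Hinv φ (εb * n)) / φ 1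

noncomputable def deltaSeq (φ : ℝ → ℝ) (εb : ℝ) (k : ℕ) : ℝ := εb * deriv φ (Hinv φ (εb * k))

noncomputable def bbar (φ : ℝ → ℝ) (εb bV : ℝ) : ℝ := 2 * bV + εb * φ 1

noncomputable def Mone (φ : ℝ → ℝ) (εb εν bV cV : ℝ) : ℝ :=
  rate φ εb 1 * (1 + 2 * rate φ εb 1 / (εb * φ 1) * ((bV + cV) / (1 - εν) - 1))

noncomputable def cstar (φ : ℝ → ℝ) (εb εν bV cV : ℝ) : ℝ :=
  ∑' j : ℕ, (1 - εν) ^ j * ∏ k ∈ Finset.Icc 1 j, (1 + deltaSeq φ εb k * Mone φ εb εν bV cV)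

noncomputable def cconst (φ : ℝ → ℝ) (εb εν bV cV : ℝ) : ℝ :=
  2 / (εb * φ 1) * (2 + bbar φ εb bV / εν +
    cstar φ εb εν bV cV * bbar φ εb bV * rate φ εb 1 * (1 + rate φ εb 1 / (εb * φ 1)))

noncomputable def Qmeas {X : Type*} [MeasurableSpace X]
    (P : ℕ → Kernel X X) (ν : ℕ → Measure X) (εν : ℝ) (k : ℕ) (x : X) : Measure X :=
  (ENNReal.ofReal (1 - εν))⁻¹ • (P k x - ENNReal.ofReal εν • ν k)

/-- The drift functions `φ : [1, ∞) → (0, ∞)`: concave, non-decreasing and differentiable. -/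
structure IsDriftFun (φ : ℝ → ℝ) : Prop where
  concave : ConcaveOn ℝ (Set.Ici 1) φ
  mono : MonotoneOn φ (Set.Ici 1)
  diff : ∀ t, 1 ≤ t → DifferentiableAt ℝ φ t
  pos : ∀ t, 1 ≤ t → 0 < φ t

namespace IsDriftFun

variable {φ : ℝ → ℝ}

lemma le_tangent (h : IsDriftFun φ) {s t : ℝ} (hs : 1 ≤ s) (ht : 1 ≤ t) :
    φ t ≤ φ s + deriv φ s * (t - s) := by
  rcases lt_trichotomy s t with hst | rfl | hst
  · have := h.concave.slope_le_of_hasDerivAt hs ht hst (h.diff s hs).hasDerivAt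
    rw [slope_def_field, div_le_iff₀ (by linarith)] at this
    linarith
  · simp
  · have := h.concave.le_slope_of_hasDerivAt ht hs hst (h.diff s hs).hasDerivAt
    rw [slope_def_field, le_div_iff₀ (by linarith)] at this
    linarith

lemma deriv_antitone (h : IsDriftFun φ) : AntitoneOn (deriv φ) (Set.Ici 1) := by
  intro s hs t ht hst
  rcases hst.eq_or_lt with rfl | hst
  · exact le_rfl
  · have h1 := h.le_tangent (s := s) (t := t) hs ht
    have h2 := h.le_tangent (s := t) (t := s) ht hs
    nlinarith

lemma deriv_nonneg (h : IsDriftFun φ) {s : ℝ} (hs : 1 ≤ s) : 0 ≤ deriv φ s := by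
  have h1 := h.le_tangent (s := s) (t := s + 1) hs (by linarith)
  have h2 := h.mono (a := s) (b := s + 1) hs (by simp; linarith) (by linarith)
  linarith

lemma add_sub_one_le (h : IsDriftFun φ) {a b : ℝ} (ha : 1 ≤ a) (hb : 1 ≤ b) :
    φ (a + b - 1) ≤ φ a + φ b := by
  wlog hab : a ≤ b generalizing a b
  · have := this hb ha (le_of_not_ge hab)
    rw [add_comm b a] at this
    linarith
  have h1 := h.le_tangent (s := b) (t := a + b - 1) hb (by linarith)
  have h2 := h.le_tangent (s := a) (t := 1) ha le_rfl
  have h3 := h.deriv_antitone (a := a) (b := b) ha hb hab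
  have h4 := h.pos 1 le_rfl
  nlinarith

lemma continuousOn (h : IsDriftFun φ) : ContinuousOn φ (Set.Ici 1) :=
  fun t ht => (h.diff t ht).continuousAt.continuousWithinAt

lemma inv_continuousOn (h : IsDriftFun φ) : ContinuousOn (fun s => (φ s)⁻¹) (Set.Ici 1) :=
  h.continuousOn.inv₀ fun t ht => (h.pos t ht).ne'

lemma intervalIntegrable (h : IsDriftFun φ) {a b : ℝ} (ha : 1 ≤ a) (hb : 1 ≤ b) :
    IntervalIntegrable (fun s => (φ s)⁻¹) volume a b :=
  (h.inv_continuousOn.mono fun _ hx => le_trans (le_min ha hb) hx.1).intervalIntegrable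

lemma Hfun_sub (h : IsDriftFun φ) {a b : ℝ} (ha : 1 ≤ a) (hb : 1 ≤ b) :
    Hfun φ b - Hfun φ a = ∫ s in a..b, (φ s)⁻¹ :=
  intervalIntegral.integral_interval_sub_left (h.intervalIntegrable le_rfl hb)
    (h.intervalIntegrable le_rfl ha)

@[simp] lemma Hfun_one : Hfun φ 1 = 0 := by simp [Hfun]

lemma Hfun_sub_le (h : IsDriftFun φ) {a b : ℝ} (ha : 1 ≤ a) (hab : a ≤ b) :
    Hfun φ b - Hfun φ a ≤ (b - a) / φ a := by
  rw [h.Hfun_sub ha (ha.trans hab)]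
  calc _ ≤ ∫ _ in a..b, (φ a)⁻¹ := by
        refine intervalIntegral.integral_mono_on hab (h.intervalIntegrable ha (ha.trans hab))
          (by simp) fun x hx => ?_
        exact inv_anti₀ (h.pos a ha) (h.mono ha (ha.trans hx.1) hx.1)
    _ = _ := by simp [div_eq_mul_inv]

lemma le_Hfun_sub (h : IsDriftFun φ) {a b : ℝ} (ha : 1 ≤ a) (hab : a ≤ b) :
    (b - a) / φ b ≤ Hfun φ b - Hfun φ a := by
  rw [h.Hfun_sub ha (ha.trans hab)]
  calc _ = ∫ _ in a..b, (φ b)⁻¹ := by simp [div_eq_mul_inv]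
    _ ≤ _ := by
        refine intervalIntegral.integral_mono_on hab (by simp)
          (h.intervalIntegrable ha (ha.trans hab)) fun x hx => ?_
        exact inv_anti₀ (h.pos x (ha.trans hx.1)) (h.mono (ha.trans hx.1) (ha.trans hab) hx.2)

lemma Hfun_strictMonoOn (h : IsDriftFun φ) : StrictMonoOn (Hfun φ) (Set.Ici 1) := by
  intro a ha b hb hab
  have := h.le_Hfun_sub ha hab.le
  have : 0 < (b - a) / φ b := div_pos (by linarith) (h.pos b hb)
  linarith

lemma Hfun_nonneg (h : IsDriftFun φ) {t : ℝ} (ht : 1 ≤ t) : 0 ≤ Hfun φ t := by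
  have := h.Hfun_strictMonoOn.monotoneOn (a := 1) (b := t) (by simp) ht ht
  simpa using this

lemma Hfun_hasDerivAt (h : IsDriftFun φ) {t : ℝ} (ht : 1 < t) :
    HasDerivAt (Hfun φ) (φ t)⁻¹ t := by
  refine intervalIntegral.integral_hasDerivAt_right (h.intervalIntegrable le_rfl ht.le) ?_ ?_
  · exact (h.inv_continuousOn.mono Set.Ioi_subset_Ici_self).stronglyMeasurableAtFilter
      isOpen_Ioi t ht
  · exact h.inv_continuousOn.continuousAt (Ici_mem_nhds ht)

lemma Hfun_continuousOn (h : IsDriftFun φ) : ContinuousOn (Hfun φ) (Set.Ici 1) := by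
  have : LipschitzOnWith (Real.toNNReal (φ 1)⁻¹) (Hfun φ) (Set.Ici 1) := by
    refine LipschitzOnWith.of_le_add_mul _ fun a ha b hb => ?_
    have h1 : 0 < φ 1 := h.pos 1 le_rfl
    rw [Real.coe_toNNReal _ (inv_nonneg.2 h1.le)]
    rcases le_total a b with hab | hab
    · have := h.Hfun_strictMonoOn.monotoneOn ha hb hab
      have : 0 ≤ (φ 1)⁻¹ * dist a b := by positivity
      linarith
    · have h2 := h.Hfun_sub_le hb hab
      have h3 : (a - b) / φ b ≤ (φ 1)⁻¹ * dist a b := by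
        rw [Real.dist_eq, abs_of_nonneg (by linarith), div_eq_inv_mul]
        gcongr
        exact h.mono (by simp) hb hb
      linarith
  exact this.continuousOn

lemma tendsto_Hfun (h : IsDriftFun φ) : Tendsto (Hfun φ) atTop atTop := by
  set A := φ 1 + deriv φ 1 with hA
  have hd := h.deriv_nonneg (le_refl (1 : ℝ))
  have h1 : 0 < φ 1 := h.pos 1 le_rfl
  have hA0 : 0 < A := by linarith
  have key : ∀ t, 1 ≤ t → Real.log t / A ≤ Hfun φ t := by
    intro t ht
    have hint : IntervalIntegrable (fun s : ℝ => s⁻¹) volume 1 t :=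
      (continuousOn_inv₀.mono fun x hx => by
        have : 1 ≤ x := le_trans (le_min le_rfl ht) hx.1
        simp; linarith).intervalIntegrable
    have : ∫ s in (1:ℝ)..t, A⁻¹ * s⁻¹ ≤ Hfun φ t := by
      refine intervalIntegral.integral_mono_on ht (hint.const_mul _)
        (h.intervalIntegrable le_rfl ht) fun x hx => ?_
      rw [← mul_inv]
      refine inv_anti₀ (h.pos x hx.1) ?_
      have := h.le_tangent le_rfl hx.1
      nlinarith [hx.1]
    rw [intervalIntegral.integral_const_mul, integral_inv_of_pos one_pos (by linarith),
      div_one] at this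
    rwa [div_eq_inv_mul]
  refine tendsto_atTop_mono' _ ?_ (Real.tendsto_log_atTop.atTop_div_const hA0)
  filter_upwards [eventually_ge_atTop 1] with t ht using key t ht

lemma exists_Hfun_eq (h : IsDriftFun φ) {y : ℝ} (hy : 0 ≤ y) :
    ∃ t ∈ Set.Ici (1 : ℝ), Hfun φ t = y := by
  obtain ⟨t, ht, ht1⟩ := ((h.tendsto_Hfun.eventually_ge_atTop y).and (eventually_ge_atTop 1)).exists
  obtain ⟨s, hs, hsy⟩ := intermediate_value_Icc ht1
    (h.Hfun_continuousOn.mono Set.Icc_subset_Ici_self)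
    (show y ∈ Set.Icc _ _ by simpa using ⟨hy, ht⟩)
  exact ⟨s, hs.1, hsy⟩

lemma one_le_Hinv (h : IsDriftFun φ) {y : ℝ} (hy : 0 ≤ y) : 1 ≤ Hinv φ y :=
  Function.invFunOn_mem (h.exists_Hfun_eq hy)

lemma Hfun_Hinv (h : IsDriftFun φ) {y : ℝ} (hy : 0 ≤ y) : Hfun φ (Hinv φ y) = y :=
  Function.invFunOn_eq (h.exists_Hfun_eq hy)

lemma Hinv_Hfun (h : IsDriftFun φ) {t : ℝ} (ht : 1 ≤ t) : Hinv φ (Hfun φ t) = t :=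
  h.Hfun_strictMonoOn.injOn (h.one_le_Hinv (h.Hfun_nonneg ht)) ht (h.Hfun_Hinv (h.Hfun_nonneg ht))

lemma Hinv_zero (h : IsDriftFun φ) : Hinv φ 0 = 1 := by
  simpa using h.Hinv_Hfun (le_refl (1 : ℝ))

lemma Hinv_strictMonoOn (h : IsDriftFun φ) : StrictMonoOn (Hinv φ) (Set.Ici 0) := by
  intro a ha b hb hab
  rw [← h.Hfun_strictMonoOn.lt_iff_lt (h.one_le_Hinv ha) (h.one_le_Hinv hb), h.Hfun_Hinv ha,
    h.Hfun_Hinv hb]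
  exact hab

lemma Hinv_sub_le (h : IsDriftFun φ) {a b : ℝ} (ha : 0 ≤ a) (hab : a ≤ b) :
    Hinv φ b - Hinv φ a ≤ φ (Hinv φ b) * (b - a) := by
  have hb := ha.trans hab
  have := h.le_Hfun_sub (h.one_le_Hinv ha) (h.Hinv_strictMonoOn.monotoneOn ha hb hab)
  rw [h.Hfun_Hinv ha, h.Hfun_Hinv hb, div_le_iff₀ (h.pos _ (h.one_le_Hinv hb))] at this
  linarith

lemma le_Hinv_sub (h : IsDriftFun φ) {a b : ℝ} (ha : 0 ≤ a) (hab : a ≤ b) :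
    φ (Hinv φ a) * (b - a) ≤ Hinv φ b - Hinv φ a := by
  have hb := ha.trans hab
  have := h.Hfun_sub_le (h.one_le_Hinv ha) (h.Hinv_strictMonoOn.monotoneOn ha hb hab)
  rw [h.Hfun_Hinv ha, h.Hfun_Hinv hb, le_div_iff₀ (h.pos _ (h.one_le_Hinv ha))] at this
  linarith

lemma Hinv_continuousOn (h : IsDriftFun φ) : ContinuousOn (Hinv φ) (Set.Ici 0) := by
  have hloc : ∀ M, 0 ≤ M → ContinuousOn (Hinv φ) (Set.Icc 0 M) := by
    intro M hM
    have : LipschitzOnWith (Real.toNNReal (φ (Hinv φ M))) (Hinv φ) (Set.Icc 0 M) := by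
      refine LipschitzOnWith.of_le_add_mul _ fun a ha b hb => ?_
      have h1 := h.pos _ (h.one_le_Hinv hM)
      rw [Real.coe_toNNReal _ h1.le]
      rcases le_total a b with hab | hab
      · have := h.Hinv_strictMonoOn.monotoneOn ha.1 hb.1 hab
        have : 0 ≤ φ (Hinv φ M) * dist a b := by positivity
        linarith
      · have h2 := h.Hinv_sub_le hb.1 hab
        have h3 : φ (Hinv φ a) * (a - b) ≤ φ (Hinv φ M) * dist a b := by
          rw [Real.dist_eq, abs_of_nonneg (by linarith)]
          gcongr
          exact h.mono (h.one_le_Hinv ha.1) (h.one_le_Hinv hM)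
            (h.Hinv_strictMonoOn.monotoneOn ha.1 hM ha.2)
        linarith
    exact this.continuousOn
  intro t ht
  refine ((hloc (t + 1) (by linarith [show (0:ℝ) ≤ t from ht])) t
    ⟨ht, by linarith⟩).mono_of_mem_nhdsWithin ?_
  exact Filter.mem_of_superset (inter_mem_nhdsWithin _ (Iic_mem_nhds (lt_add_one t)))
    fun x hx => ⟨hx.1, hx.2⟩

lemma Hinv_hasDerivAt (h : IsDriftFun φ) {t : ℝ} (ht : 0 < t) :
    HasDerivAt (Hinv φ) (φ (Hinv φ t)) t := by
  have h1 : 1 < Hinv φ t := by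
    have := h.Hinv_strictMonoOn (a := 0) (b := t) (by simp) ht.le ht
    rwa [h.Hinv_zero] at this
  have := HasDerivAt.of_local_left_inverse (f := Hfun φ) (g := Hinv φ) (a := t)
    (h.Hinv_continuousOn.continuousAt (Ici_mem_nhds ht)) (h.Hfun_hasDerivAt h1)
    (inv_ne_zero (h.pos _ h1.le).ne')
    (by filter_upwards [Ioi_mem_nhds ht] with y hy using h.Hfun_Hinv (le_of_lt hy))
  simpa using this

/-- Log-concavity of `φ ∘ H⁻¹`. -/
lemma ratio_le (h : IsDriftFun φ) {a b c : ℝ} (ha : 0 ≤ a) (hab : a ≤ b) (hc : 0 ≤ c) :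
    φ (Hinv φ (b + c)) * φ (Hinv φ a) ≤ φ (Hinv φ (a + c)) * φ (Hinv φ b) := by
  have hpos : ∀ t, 0 ≤ t → 0 < φ (Hinv φ t) := fun t ht => h.pos _ (h.one_le_Hinv ht)
  have hcontφ : ContinuousOn (fun t => φ (Hinv φ t)) (Set.Ici 0) :=
    h.continuousOn.comp h.Hinv_continuousOn fun t ht => h.one_le_Hinv ht
  have hd : ∀ t, 0 < t → HasDerivAt (fun t => Real.log (φ (Hinv φ t))) (deriv φ (Hinv φ t)) t := by
    intro t ht
    have := ((h.diff _ (h.one_le_Hinv ht.le)).hasDerivAt.comp t (h.Hinv_hasDerivAt ht)).log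
      (hpos t ht.le).ne'
    simpa [(hpos t ht.le).ne'] using this
  have hcont : ContinuousOn (fun t => Real.log (φ (Hinv φ t))) (Set.Ici 0) :=
    hcontφ.log fun t ht => (hpos t ht).ne'
  have hanti : AntitoneOn
      (fun t => Real.log (φ (Hinv φ (t + c))) - Real.log (φ (Hinv φ t))) (Set.Ici 0) := by
    refine antitoneOn_of_hasDerivWithinAt_nonpos (convex_Ici 0)
      (f' := fun t => deriv φ (Hinv φ (t + c)) - deriv φ (Hinv φ t)) ?_ ?_ ?_
    · exact (hcont.comp (by fun_prop) fun t ht => add_nonneg ht hc).sub hcont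
    · intro t ht
      rw [interior_Ici] at ht
      exact (((hd (t + c) (add_pos_of_pos_of_nonneg ht hc)).comp_add_const t c).sub
        (hd t ht)).hasDerivWithinAt
    · intro t ht
      rw [interior_Ici] at ht
      have ht' : 0 ≤ t := le_of_lt ht
      exact sub_nonpos.2 <| h.deriv_antitone (h.one_le_Hinv ht') (h.one_le_Hinv (add_nonneg ht' hc))
        (h.Hinv_strictMonoOn.monotoneOn ht' (add_nonneg ht' hc) (by linarith))
  have hb := ha.trans hab
  have := hanti ha hb hab
  simp only at this
  have p1 := hpos _ ha
  have p2 := hpos _ hb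
  have p3 := hpos _ (add_nonneg ha hc)
  have p4 := hpos _ (add_nonneg hb hc)
  rw [← Real.log_le_log_iff (by positivity) (by positivity), Real.log_mul p4.ne' p1.ne',
    Real.log_mul p3.ne' p2.ne']
  linarith

lemma Hinv_add_sub_le (h : IsDriftFun φ) {c σ τ : ℝ} (hc : 0 ≤ c) (hσ : 0 ≤ σ) (hτ : 0 ≤ τ) :
    Hinv φ (σ + c) - Hinv φ (τ + c) ≤
      φ (Hinv φ (τ + c)) / φ (Hinv φ τ) * (Hinv φ σ - Hinv φ τ) := by
  have hpos : ∀ t, 0 ≤ t → 0 < φ (Hinv φ t) := fun t ht => h.pos _ (h.one_le_Hinv ht)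
  have mvt : ∀ a b, 0 ≤ a → a < b → ∃ ξ ∈ Set.Ioo a b,
      (Hinv φ b - Hinv φ a) * φ (Hinv φ (ξ + c)) =
        (Hinv φ (b + c) - Hinv φ (a + c)) * φ (Hinv φ ξ) := by
    intro a b ha hab
    refine exists_ratio_hasDerivAt_eq_ratio_slope (fun t => Hinv φ (t + c)) _ hab ?_ ?_
      (Hinv φ) _ ?_ ?_
    · exact h.Hinv_continuousOn.comp (by fun_prop) fun t ht => add_nonneg (ha.trans ht.1) hc
    · intro t ht
      exact (h.Hinv_hasDerivAt (by linarith [ht.1])).comp_add_const t c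
    · exact h.Hinv_continuousOn.mono fun t ht => ha.trans ht.1
    · intro t ht
      exact h.Hinv_hasDerivAt (by linarith [ht.1])
  rw [div_mul_eq_mul_div, le_div_iff₀ (hpos τ hτ)]
  rcases lt_trichotomy σ τ with hst | rfl | hst
  · obtain ⟨ξ, hξ, heq⟩ := mvt σ τ hσ hst
    have hξ0 := hσ.trans hξ.1.le
    have h1 := h.ratio_le hξ0 hξ.2.le hc
    have h2 := h.Hinv_strictMonoOn hσ hτ hst
    have h3 := hpos ξ hξ0
    refine le_of_mul_le_mul_right ?_ h3
    linear_combination mul_le_mul_of_nonneg_left h1 (sub_pos.2 h2).le + φ (Hinv φ τ) * heq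
  · simp
  · obtain ⟨ξ, hξ, heq⟩ := mvt τ σ hτ hst
    have hξ0 := hτ.trans hξ.1.le
    have h1 := h.ratio_le hτ hξ.1.le hc
    have h2 := h.Hinv_strictMonoOn hτ hσ hst
    have h3 := hpos ξ hξ0
    refine le_of_mul_le_mul_right ?_ h3
    linear_combination mul_le_mul_of_nonneg_left h1 (sub_pos.2 h2).le - φ (Hinv φ τ) * heq

lemma tendsto_Hinv (h : IsDriftFun φ) : Tendsto (Hinv φ) atTop atTop := by
  refine tendsto_atTop.2 fun M => ?_
  filter_upwards [eventually_ge_atTop (Hfun φ (max M 1))] with t ht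
  have h1 := h.Hfun_nonneg (le_max_right M 1)
  have := h.Hinv_strictMonoOn.monotoneOn h1 (h1.trans ht) ht
  rw [h.Hinv_Hfun (le_max_right M 1)] at this
  exact (le_max_left M 1).trans this

end IsDriftFun

/-- The Lyapunov functions `v ↦ H⁻¹(H(v) + c k) - H⁻¹(c k)`, where `H = Hfun φ`. -/
noncomputable def lyap (φ : ℝ → ℝ) (c : ℝ) (k : ℕ) (v : ℝ) : ℝ :=
  Hinv φ (Hfun φ v + c * k) - Hinv φ (c * k)

/-- The derivative of `lyap φ c k` at `v`. -/
noncomputable def lyapSlope (φ : ℝ → ℝ) (c : ℝ) (k : ℕ) (v : ℝ) : ℝ :=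
  φ (Hinv φ (Hfun φ v + c * k)) / φ v

namespace IsDriftFun

variable {φ : ℝ → ℝ} {c : ℝ}

lemma phi_Hinv_pos (h : IsDriftFun φ) {t : ℝ} (ht : 0 ≤ t) : 0 < φ (Hinv φ t) :=
  h.pos _ (h.one_le_Hinv ht)

lemma phi_Hinv_le (h : IsDriftFun φ) {s t : ℝ} (hs : 0 ≤ s) (hst : s ≤ t) :
    φ (Hinv φ s) ≤ φ (Hinv φ t) :=
  h.mono (h.one_le_Hinv hs) (h.one_le_Hinv (hs.trans hst))
    (h.Hinv_strictMonoOn.monotoneOn hs (hs.trans hst) hst)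

lemma rate_zero (h : IsDriftFun φ) : rate φ c 0 = 1 := by
  simp [rate, h.Hinv_zero, (h.pos 1 le_rfl).ne']

lemma rate_mono (h : IsDriftFun φ) (hc : 0 ≤ c) : Monotone (rate φ c) := by
  intro m n hmn
  have := h.pos 1 le_rfl
  unfold rate
  gcongr
  exact h.phi_Hinv_le (by positivity) (by gcongr)

lemma one_le_rate (h : IsDriftFun φ) (hc : 0 ≤ c) (n : ℕ) : 1 ≤ rate φ c n := by
  simpa [h.rate_zero] using h.rate_mono hc (Nat.zero_le n)

lemma rate_succ_le_mul (h : IsDriftFun φ) (hc : 0 ≤ c) (n : ℕ) :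
    rate φ c (n + 1) ≤ rate φ c n * rate φ c 1 := by
  have h1 := h.pos 1 le_rfl
  have := h.ratio_le (a := 0) (b := c * n) (c := c) le_rfl (by positivity) hc
  rw [h.Hinv_zero, zero_add] at this
  unfold rate
  rw [div_mul_div_comm, div_le_div_iff₀ h1 (by positivity)]
  push_cast
  rw [mul_add, mul_one]
  nlinarith

lemma rate_succ_le_add (h : IsDriftFun φ) (hc : 0 ≤ c) (n : ℕ) :
    rate φ c (n + 1) ≤ rate φ c n + deltaSeq φ c n * rate φ c (n + 1) := by
  have h1 := h.pos 1 le_rfl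
  have hn : 0 ≤ c * n := by positivity
  have hle : c * n ≤ c * (n + 1 : ℕ) := by gcongr; omega
  have ht := h.le_tangent (h.one_le_Hinv hn) (h.one_le_Hinv (hn.trans hle))
  have hd := mul_le_mul_of_nonneg_left (h.Hinv_sub_le hn hle) (h.deriv_nonneg (h.one_le_Hinv hn))
  unfold rate deltaSeq
  rw [mul_div_assoc', ← add_div]
  gcongr
  push_cast at *
  linarith

lemma deltaSeq_nonneg (h : IsDriftFun φ) (hc : 0 ≤ c) (n : ℕ) : 0 ≤ deltaSeq φ c n :=
  mul_nonneg hc (h.deriv_nonneg (h.one_le_Hinv (by positivity)))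

lemma deltaSeq_antitone (h : IsDriftFun φ) (hc : 0 ≤ c) : Antitone (deltaSeq φ c) := by
  intro m n hmn
  have hm : 0 ≤ c * m := by positivity
  have hle : c * m ≤ c * n := by gcongr
  exact mul_le_mul_of_nonneg_left (h.deriv_antitone (h.one_le_Hinv hm)
    (h.one_le_Hinv (hm.trans hle)) (h.Hinv_strictMonoOn.monotoneOn hm (hm.trans hle) hle)) hc

lemma tendsto_deltaSeq (h : IsDriftFun φ) (hc : 0 < c)
    (hd : Tendsto (deriv φ) atTop (nhds 0)) : Tendsto (deltaSeq φ c) atTop (nhds 0) := by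
  have h1 : Tendsto (fun k : ℕ => c * (k : ℝ)) atTop atTop :=
    tendsto_natCast_atTop_atTop.const_mul_atTop hc
  have := ((hd.comp h.tendsto_Hinv).comp h1).const_mul c
  rwa [mul_zero] at this

lemma lyap_nonneg (h : IsDriftFun φ) (hc : 0 ≤ c) (k : ℕ) {v : ℝ} (hv : 1 ≤ v) :
    0 ≤ lyap φ c k v := by
  have := h.Hfun_nonneg hv
  have hk : 0 ≤ c * k := by positivity
  exact sub_nonneg.2 (h.Hinv_strictMonoOn.monotoneOn hk (add_nonneg this hk) (by linarith))

lemma lyap_zero (h : IsDriftFun φ) {v : ℝ} (hv : 1 ≤ v) : lyap φ c 0 v = v - 1 := by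
  simp [lyap, h.Hinv_zero, h.Hinv_Hfun hv]

lemma lyap_one (k : ℕ) : lyap φ c k 1 = 0 := by simp [lyap]

lemma lyap_mono (h : IsDriftFun φ) (hc : 0 ≤ c) (k : ℕ) :
    MonotoneOn (lyap φ c k) (Set.Ici 1) := by
  intro v hv w hw hvw
  have hk : 0 ≤ c * k := by positivity
  have := h.Hfun_strictMonoOn.monotoneOn hv hw hvw
  exact sub_le_sub_right (h.Hinv_strictMonoOn.monotoneOn (add_nonneg (h.Hfun_nonneg hv) hk)
    (add_nonneg (h.Hfun_nonneg hw) hk) (by linarith)) _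

lemma lyapSlope_nonneg (h : IsDriftFun φ) (hc : 0 ≤ c) (k : ℕ) {v : ℝ} (hv : 1 ≤ v) :
    0 ≤ lyapSlope φ c k v :=
  (div_pos (h.phi_Hinv_pos (add_nonneg (h.Hfun_nonneg hv) (by positivity))) (h.pos v hv)).le

lemma lyapSlope_le (h : IsDriftFun φ) (hc : 0 ≤ c) (k : ℕ) {v : ℝ} (hv : 1 ≤ v) :
    lyapSlope φ c k v ≤ rate φ c k := by
  have := h.ratio_le (a := 0) (b := Hfun φ v) (c := c * k) le_rfl (h.Hfun_nonneg hv)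
    (by positivity)
  rw [h.Hinv_zero, zero_add, h.Hinv_Hfun hv] at this
  exact (div_le_div_iff₀ (h.pos v hv) (h.pos 1 le_rfl)).2 this

lemma lyap_le_tangent (h : IsDriftFun φ) (hc : 0 ≤ c) (k : ℕ) {v w : ℝ} (hv : 1 ≤ v)
    (hw : 1 ≤ w) : lyap φ c k w ≤ lyap φ c k v + lyapSlope φ c k v * (w - v) := by
  have := h.Hinv_add_sub_le (c := c * k) (by positivity) (h.Hfun_nonneg hw) (h.Hfun_nonneg hv)
  rw [h.Hinv_Hfun hv, h.Hinv_Hfun hw] at this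
  unfold lyap lyapSlope
  linarith

lemma lyap_le (h : IsDriftFun φ) (hc : 0 ≤ c) (k : ℕ) {v : ℝ} (hv : 1 ≤ v) :
    lyap φ c k v ≤ rate φ c k * (v - 1) := by
  have h1 := h.lyap_le_tangent hc k le_rfl hv
  have h2 := h.lyapSlope_le hc k le_rfl
  rw [lyap_one] at h1
  nlinarith

lemma lyap_succ_le (h : IsDriftFun φ) (hc : 0 ≤ c) (k : ℕ) {v : ℝ} (hv : 1 ≤ v) :
    lyap φ c (k + 1) v - lyapSlope φ c (k + 1) v * (c * φ v) ≤
      lyap φ c k v - c * φ 1 * rate φ c k := by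
  have hk : 0 ≤ c * k := by positivity
  have hH := h.Hfun_nonneg hv
  have hle : c * k ≤ c * (k + 1 : ℕ) := by gcongr; omega
  have h1 := h.Hinv_sub_le (add_nonneg hH hk) (add_le_add_right hle (Hfun φ v))
  have h2 := h.le_Hinv_sub hk hle
  have e1 : lyapSlope φ c (k + 1) v * (c * φ v) =
      c * φ (Hinv φ (Hfun φ v + c * (k + 1 : ℕ))) := by
    have := (h.pos v hv).ne'
    unfold lyapSlope
    field_simp
  have e2 : c * φ 1 * rate φ c k = c * φ (Hinv φ (c * k)) := by
    have := (h.pos 1 le_rfl).ne'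
    unfold rate
    field_simp
  rw [e1, e2]
  unfold lyap
  push_cast at *
  linarith

end IsDriftFun

/-- The partial sums of the shifted series defining `cstar`. -/
noncomputable def cpartial (q : ℝ) (a : ℕ → ℝ) (N j : ℕ) : ℝ :=
  ∑ i ∈ Finset.range N, q ^ i * ∏ k ∈ Finset.range i, a (j + k)

section cpartial

variable {q : ℝ} {a : ℕ → ℝ}

lemma cpartial_succ (N j : ℕ) :
    cpartial q a (N + 1) j = 1 + q * a j * cpartial q a N (j + 1) := by
  unfold cpartial
  rw [Finset.sum_range_succ', Finset.mul_sum, add_comm]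
  congr 1
  · simp
  · refine Finset.sum_congr rfl fun i _ => ?_
    rw [Finset.prod_range_succ', pow_succ]
    have : ∀ k, j + 1 + k = j + (k + 1) := fun k => by omega
    simp only [this, add_zero]
    ring

lemma cpartial_nonneg (hq : 0 ≤ q) (ha : ∀ k, 0 ≤ a k) (N j : ℕ) : 0 ≤ cpartial q a N j :=
  Finset.sum_nonneg fun _ _ => mul_nonneg (pow_nonneg hq _) (Finset.prod_nonneg fun _ _ => ha _)

lemma cpartial_le_succ (hq : 0 ≤ q) (ha : ∀ k, 0 ≤ a k) (N j : ℕ) :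
    cpartial q a N j ≤ cpartial q a (N + 1) j := by
  unfold cpartial
  rw [Finset.sum_range_succ]
  have : 0 ≤ q ^ N * ∏ k ∈ Finset.range N, a (j + k) :=
    mul_nonneg (pow_nonneg hq _) (Finset.prod_nonneg fun _ _ => ha _)
  linarith

lemma cpartial_one_le_tsum (hq : 0 < q) (hq1 : q < 1) (ha : ∀ k, 0 < a k)
    (hlim : Tendsto a atTop (nhds 1)) (N : ℕ) :
    cpartial q a N 1 ≤ ∑' i : ℕ, q ^ i * ∏ k ∈ Finset.Icc 1 i, a k := by
  have hpos : ∀ i, 0 < q ^ i * ∏ k ∈ Finset.Icc 1 i, a k := fun i =>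
    mul_pos (pow_pos hq _) (Finset.prod_pos fun _ _ => ha _)
  have hs : Summable fun i => q ^ i * ∏ k ∈ Finset.Icc 1 i, a k := by
    refine summable_of_ratio_test_tendsto_lt_one hq1 (Eventually.of_forall fun i => (hpos i).ne') ?_
    have : Tendsto (fun i => q * a (i + 1)) atTop (nhds (q * 1)) :=
      ((tendsto_add_atTop_iff_nat 1).2 hlim).const_mul q
    rw [mul_one] at this
    refine this.congr fun i => ?_
    rw [Real.norm_of_nonneg (hpos _).le, Real.norm_of_nonneg (hpos _).le,
      Finset.prod_Icc_succ_top (by omega), eq_div_iff (hpos i).ne']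
    ring
  have hsum : cpartial q a N 1 = ∑ i ∈ Finset.range N, q ^ i * ∏ k ∈ Finset.Icc 1 i, a k := by
    refine Finset.sum_congr rfl fun i _ => ?_
    congr 1
    have hIcc : Finset.Icc 1 i = Finset.Ico 1 (i + 1) := by ext; simp
    rw [hIcc, Finset.prod_Ico_eq_prod_range, Nat.add_sub_cancel]
  rw [hsum]
  exact hs.sum_le_tsum _ fun i _ => (hpos i).le

end cpartial

section Survival

variable {X : Type*}

/-- The probability of not coupling at a step started from a given pair. -/
noncomputable def survival (C : Set X) (ε : ℝ) (z : X × X) : ℝ :=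
  1 - ε * (C ×ˢ C).indicator 1 z

lemma survival_of_mem {C : Set X} {ε : ℝ} {z : X × X} (hz : z ∈ C ×ˢ C) :
    survival C ε z = 1 - ε := by simp [survival, hz]

lemma survival_of_notMem {C : Set X} {ε : ℝ} {z : X × X} (hz : z ∉ C ×ˢ C) :
    survival C ε z = 1 := by simp [survival, hz]

lemma survival_le_one {C : Set X} {ε : ℝ} (hε : 0 ≤ ε) (z : X × X) : survival C ε z ≤ 1 := by
  by_cases hz : z ∈ C ×ˢ C
  · rw [survival_of_mem hz]; linarith
  · rw [survival_of_notMem hz]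

lemma survival_nonneg {C : Set X} {ε : ℝ} (hε : ε ≤ 1) (z : X × X) : 0 ≤ survival C ε z := by
  by_cases hz : z ∈ C ×ˢ C
  · rw [survival_of_mem hz]; linarith
  · rw [survival_of_notMem hz]; exact zero_le_one

end Survival

section Coupling

variable {X : Type*} [MeasurableSpace X]

/-- A Markov kernel minorised by `ε ν` on `C` splits there as a mixture. -/
lemma exists_residual_kernel {C : Set X} (hC : MeasurableSet C) {ε : ℝ} (hε : ε ∈ Set.Ioo (0 : ℝ) 1)
    (P : Kernel X X) [IsMarkovKernel P] (ν : Measure X) [IsProbabilityMeasure ν]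
    (hminor : ∀ x ∈ C, ∀ A : Set X, MeasurableSet A → ENNReal.ofReal ε * ν A ≤ P x A) :
    ∃ Q : Kernel X X, IsMarkovKernel Q ∧
      ∀ x ∈ C, P x = ENNReal.ofReal ε • ν + ENNReal.ofReal (1 - ε) • Q x := by
  classical
  have hq0 : ENNReal.ofReal (1 - ε) ≠ 0 := by simpa using hε.2
  have hle : ∀ x ∈ C, ENNReal.ofReal ε • ν ≤ P x := fun x hx =>
    Measure.le_iff.2 fun s hs => by simpa using hminor x hx s hs
  have : IsFiniteMeasure (ENNReal.ofReal ε • ν) := ⟨by simp⟩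
  let R : Kernel X X :=
    { toFun := fun x => if x ∈ C then (ENNReal.ofReal (1 - ε))⁻¹ • (P x - ENNReal.ofReal ε • ν)
        else P x
      measurable' := by
        refine Measure.measurable_of_measurable_coe _ fun s hs => ?_
        have : (fun x => (if x ∈ C then (ENNReal.ofReal (1 - ε))⁻¹ • (P x - ENNReal.ofReal ε • ν)
            else P x) s) = fun x => if x ∈ C then
              (ENNReal.ofReal (1 - ε))⁻¹ * (P x s - ENNReal.ofReal ε * ν s) else P x s := by
          ext x
          split_ifs with hx
          · simp [Measure.sub_apply hs (hle x hx)]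
          · rfl
        rw [this]
        exact Measurable.ite hC (((P.measurable_coe hs).sub_const _).const_mul _)
          (P.measurable_coe hs) }
  have hR : ∀ x ∈ C, R x = (ENNReal.ofReal (1 - ε))⁻¹ • (P x - ENNReal.ofReal ε • ν) :=
    fun x hx => if_pos hx
  have hR' : ∀ x ∉ C, R x = P x := fun x hx => if_neg hx
  refine ⟨R, ⟨fun x => ⟨?_⟩⟩, fun x hx => ?_⟩
  · by_cases hx : x ∈ C
    · rw [hR x hx, Measure.smul_apply, Measure.sub_apply MeasurableSet.univ (hle x hx)]
      simp only [Measure.smul_apply, measure_univ, smul_eq_mul, mul_one]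
      rw [← ENNReal.ofReal_one, ← ENNReal.ofReal_sub _ hε.1.le, ENNReal.ofReal_one]
      exact ENNReal.inv_mul_cancel hq0 ENNReal.ofReal_ne_top
    · rw [hR' x hx, measure_univ]
  · rw [hR x hx, smul_smul, ENNReal.mul_inv_cancel hq0 ENNReal.ofReal_ne_top, one_smul, add_comm,
      Measure.sub_add_cancel_of_le (hle x hx)]

lemma measurable_survival {C : Set X} (hC : MeasurableSet C) (ε : ℝ) :
    Measurable (survival C ε) :=
  ((measurable_one.indicator (hC.prod hC)).const_mul ε).const_sub 1

/-- Conditionally on not coupling at this step, the pair moves according to `L`: independent moves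
outside `C × C`, independent residual moves inside. -/
def IsCouplingKernel (C : Set X) (ε : ℝ) (P : Kernel X X) (ν : Measure X)
    (L : Kernel (X × X) (X × X)) : Prop :=
  ∀ z, ∃ μ₁ μ₂ : Measure X, IsProbabilityMeasure μ₁ ∧ IsProbabilityMeasure μ₂ ∧
    L z = μ₁.prod μ₂ ∧
    (z ∉ C ×ˢ C → P z.1 = μ₁ ∧ P z.2 = μ₂) ∧
    (z ∈ C ×ˢ C → P z.1 = ENNReal.ofReal ε • ν + ENNReal.ofReal (1 - ε) • μ₁ ∧
      P z.2 = ENNReal.ofReal ε • ν + ENNReal.ofReal (1 - ε) • μ₂)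

lemma exists_couplingKernel {C : Set X} (hC : MeasurableSet C) {ε : ℝ}
    (hε : ε ∈ Set.Ioo (0 : ℝ) 1)
    (P : Kernel X X) [IsMarkovKernel P] (ν : Measure X) [IsProbabilityMeasure ν]
    (hminor : ∀ x ∈ C, ∀ A : Set X, MeasurableSet A → ENNReal.ofReal ε * ν A ≤ P x A) :
    ∃ L : Kernel (X × X) (X × X), IsMarkovKernel L ∧ IsCouplingKernel C ε P ν L := by
  classical
  obtain ⟨Q, hQ, hPQ⟩ := exists_residual_kernel hC hε P ν hminor
  refine ⟨Kernel.piecewise (hC.prod hC) (Q ∥ₖ Q) (P ∥ₖ P), inferInstance, fun z => ?_⟩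
  by_cases hz : z ∈ C ×ˢ C
  · refine ⟨Q z.1, Q z.2, inferInstance, inferInstance, ?_, fun h => absurd hz h,
      fun _ => ⟨hPQ _ hz.1, hPQ _ hz.2⟩⟩
    rw [Kernel.piecewise_apply, if_pos hz, Kernel.parallelComp_apply]
  · refine ⟨P z.1, P z.2, inferInstance, inferInstance, ?_, fun _ => ⟨rfl, rfl⟩,
      fun h => absurd h hz⟩
    rw [Kernel.piecewise_apply, if_neg hz, Kernel.parallelComp_apply]

lemma integrable_of_mixture {ε : ℝ} (hε : ε ∈ Set.Ioo (0 : ℝ) 1) {ρ ν μ : Measure X}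
    (h : ρ = ENNReal.ofReal ε • ν + ENNReal.ofReal (1 - ε) • μ) {u : X → ℝ} (hu : Integrable u ρ) :
    Integrable u ν ∧ Integrable u μ ∧ ∫ y, u y ∂ρ = ε * ∫ y, u y ∂ν + (1 - ε) * ∫ y, u y ∂μ := by
  have h1 : ENNReal.ofReal ε ≠ 0 := by simpa using hε.1
  have h2 : ENNReal.ofReal (1 - ε) ≠ 0 := by simpa using hε.2
  rw [h, integrable_add_measure, integrable_smul_measure h1 ENNReal.ofReal_ne_top,
    integrable_smul_measure h2 ENNReal.ofReal_ne_top] at hu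
  refine ⟨hu.1, hu.2, ?_⟩
  rw [h, integral_add_measure (hu.1.smul_measure ENNReal.ofReal_ne_top)
    (hu.2.smul_measure ENNReal.ofReal_ne_top), integral_smul_measure, integral_smul_measure,
    ENNReal.toReal_ofReal hε.1.le, ENNReal.toReal_ofReal (by linarith [hε.2]), smul_eq_mul,
    smul_eq_mul]

namespace IsCouplingKernel

variable {C : Set X} {ε : ℝ} {P : Kernel X X} {ν : Measure X} {L : Kernel (X × X) (X × X)}

lemma integrable (h : IsCouplingKernel C ε P ν L) (hε : ε ∈ Set.Ioo (0 : ℝ) 1) {u : X → ℝ}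
    (hu : ∀ x, Integrable u (P x)) (z : X × X) :
    Integrable (fun y => u y.1) (L z) ∧ Integrable (fun y => u y.2) (L z) := by
  obtain ⟨μ₁, μ₂, _, _, hL, hout, hin⟩ := h z
  rw [hL]
  have : Integrable u μ₁ ∧ Integrable u μ₂ := by
    by_cases hz : z ∈ C ×ˢ C
    · exact ⟨(integrable_of_mixture hε (hin hz).1 (hu _)).2.1,
        (integrable_of_mixture hε (hin hz).2 (hu _)).2.1⟩
    · rw [← (hout hz).1, ← (hout hz).2]
      exact ⟨hu _, hu _⟩
  exact ⟨this.1.comp_fst _, this.2.comp_snd _⟩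

lemma integral_sub (h : IsCouplingKernel C ε P ν L) (hε : ε ∈ Set.Ioo (0 : ℝ) 1) {u : X → ℝ}
    (hu : ∀ x, Integrable u (P x)) (z : X × X) :
    survival C ε z * ∫ y, (u y.1 - u y.2) ∂L z = ∫ y, u y ∂P z.1 - ∫ y, u y ∂P z.2 := by
  have hi := h.integrable hε hu z
  rw [MeasureTheory.integral_sub hi.1 hi.2]
  obtain ⟨μ₁, μ₂, _, _, hL, hout, hin⟩ := h z
  rw [hL, integral_fun_fst, integral_fun_snd]
  by_cases hz : z ∈ C ×ˢ C
  · rw [survival_of_mem hz, (integrable_of_mixture hε (hin hz).1 (hu _)).2.2,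
      (integrable_of_mixture hε (hin hz).2 (hu _)).2.2]
    simp
    ring
  · rw [survival_of_notMem hz, (hout hz).1, (hout hz).2]
    simp

lemma integral_add_le (h : IsCouplingKernel C ε P ν L) (hε : ε ∈ Set.Ioo (0 : ℝ) 1)
    [IsProbabilityMeasure ν] {V : X → ℝ} (hV : ∀ x, 1 ≤ V x)
    (hu : ∀ x, Integrable V (P x)) (z : X × X) :
    survival C ε z * ∫ y, (V y.1 + V y.2 - 2) ∂L z ≤
        ∫ y, V y ∂P z.1 + ∫ y, V y ∂P z.2 - 2 ∧
      (z ∈ C ×ˢ C → (1 - ε) * ∫ y, (V y.1 + V y.2) ∂L z ≤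
        ∫ y, V y ∂P z.1 + ∫ y, V y ∂P z.2) := by
  have hi := h.integrable hε hu z
  obtain ⟨μ₁, μ₂, _, _, hL, hout, hin⟩ := h z
  have hadd : Integrable (fun y => V y.1 + V y.2) (L z) := hi.1.add hi.2
  rw [MeasureTheory.integral_sub hadd (by rw [hL]; exact integrable_const _),
    MeasureTheory.integral_add hi.1 hi.2, hL, integral_fun_fst, integral_fun_snd]
  by_cases hz : z ∈ C ×ˢ C
  · have e1 := integrable_of_mixture hε (hin hz).1 (hu _)
    have e2 := integrable_of_mixture hε (hin hz).2 (hu _)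
    have hν : 1 ≤ ∫ y, V y ∂ν := by
      have := integral_mono (integrable_const (1 : ℝ)) e1.1 hV
      simpa using this
    rw [survival_of_mem hz, e1.2.2, e2.2.2]
    simp only [probReal_univ, integral_const, smul_eq_mul]
    constructor
    · nlinarith [hε.1]
    · intro _
      nlinarith [hε.1]
  · refine ⟨?_, fun h => absurd h hz⟩
    rw [survival_of_notMem hz, (hout hz).1, (hout hz).2]
    simp

end IsCouplingKernel

end Coupling

/-- The bivariate function `V(x) + V(x') - 1`. -/
def pairV {X : Type*} (V : X → ℝ) (z : X × X) : ℝ := V z.1 + V z.2 - 1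

lemma one_le_pairV {X : Type*} {V : X → ℝ} (hV : ∀ x, 1 ≤ V x) (z : X × X) : 1 ≤ pairV V z := by
  have := hV z.1
  have := hV z.2
  unfold pairV
  linarith

section Drift

variable {X : Type*} [MeasurableSpace X]

lemma measurable_pairV {V : X → ℝ} (hV : Measurable V) : Measurable (pairV V) :=
  ((hV.comp measurable_fst).add (hV.comp measurable_snd)).sub_const 1

lemma measurable_comp_of_monotoneOn {Y : Type*} [MeasurableSpace Y] {g : ℝ → ℝ}
    (hg : MonotoneOn g (Set.Ici 1)) {U : Y → ℝ} (hU : Measurable U) (hU1 : ∀ y, 1 ≤ U y) :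
    Measurable fun y => g (U y) := by
  have hm : Monotone fun t => g (max 1 t) := fun s t hst =>
    hg (Set.mem_Ici.2 (le_max_left _ _)) (Set.mem_Ici.2 (le_max_left _ _)) (max_le_max le_rfl hst)
  have : (fun y => g (U y)) = (fun t => g (max 1 t)) ∘ U := by
    ext y
    simp [max_eq_right (hU1 y)]
  rw [this]
  exact hm.measurable.comp hU

lemma integrable_of_abs_le_add_mul {μ : Measure X} [IsFiniteMeasure μ] {U g : X → ℝ}
    (hU : Integrable U μ) (hg : Measurable g) {a b : ℝ} (hle : ∀ y, |g y| ≤ a + b * U y) :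
    Integrable g μ :=
  ((integrable_const a).add (hU.const_mul b)).mono' hg.aestronglyMeasurable
    (Eventually.of_forall hle)

/-- One-step drift and splitting assumptions for a single kernel. -/
structure DriftStep (φ : ℝ → ℝ) (c ε bV cV : ℝ) (C : Set X) (V : X → ℝ) (P : Kernel X X)
    (ν : Measure X) (L : Kernel (X × X) (X × X)) : Prop where
  driftFun : IsDriftFun φ
  rate_mem : c ∈ Set.Ioo (0 : ℝ) 1
  minor_mem : ε ∈ Set.Ioo (0 : ℝ) 1
  bV_pos : 0 < bV
  measurable_V : Measurable V
  one_le_V : ∀ x, 1 ≤ V x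
  integrable_V : ∀ x, Integrable V (P x)
  drift : ∀ x, ∫ y, V y ∂P x ≤ V x - φ (V x) + bV * C.indicator 1 x
  outside : ∀ x ∉ C, bV ≤ (1 - c) * φ (V x)
  inside : ∀ x ∈ C, V x ≤ cV
  prob_ν : IsProbabilityMeasure ν
  markov_L : IsMarkovKernel L
  coupling : IsCouplingKernel C ε P ν L

namespace DriftStep

variable {φ : ℝ → ℝ} {c ε bV cV : ℝ} {C : Set X} {V : X → ℝ} {P : Kernel X X} {ν : Measure X}
  {L : Kernel (X × X) (X × X)}

lemma integrable_pairV (h : DriftStep φ c ε bV cV C V P ν L) (z : X × X) :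
    Integrable (pairV V) (L z) := by
  have := h.markov_L
  have hi := h.coupling.integrable h.minor_mem h.integrable_V z
  exact (hi.1.add hi.2).sub (integrable_const 1)

lemma pairV_drift (h : DriftStep φ c ε bV cV C V P ν L) (z : X × X) :
    survival C ε z * ∫ y, (pairV V y - 1) ∂L z ≤
      pairV V z - 1 - c * (φ (V z.1) + φ (V z.2)) + 2 * bV * (C ×ˢ C).indicator 1 z := by
  have := h.prob_ν
  have hle := (h.coupling.integral_add_le h.minor_mem h.one_le_V h.integrable_V z).1
  have e : ∀ y : X × X, pairV V y - 1 = V y.1 + V y.2 - 2 := fun y => by unfold pairV; ring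
  simp only [e]
  refine hle.trans ?_
  have d1 := h.drift z.1
  have d2 := h.drift z.2
  have p1 := h.driftFun.pos _ (h.one_le_V z.1)
  have p2 := h.driftFun.pos _ (h.one_le_V z.2)
  have hb := h.bV_pos
  have hc := h.rate_mem
  have q1 : 0 < (1 - c) * φ (V z.1) := mul_pos (by linarith [hc.2]) p1
  have q2 : 0 < (1 - c) * φ (V z.2) := mul_pos (by linarith [hc.2]) p2
  by_cases h1 : z.1 ∈ C <;> by_cases h2 : z.2 ∈ C
  · simp only [h1, h2, Set.indicator_of_mem, Set.mem_prod, and_self,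
      Pi.one_apply] at *
    linarith
  · have := h.outside _ h2
    simp only [h1, h2, Set.indicator_of_mem, Set.indicator_of_notMem, Set.mem_prod, and_false,
      not_false_eq_true, Pi.one_apply] at *
    linarith
  · have := h.outside _ h1
    simp only [h1, h2, Set.indicator_of_mem, Set.indicator_of_notMem, Set.mem_prod, false_and,
      not_false_eq_true, Pi.one_apply] at *
    linarith
  · simp only [h1, h2, Set.indicator_of_notMem, Set.mem_prod, and_self,
      not_false_eq_true] at *
    linarith

lemma integral_pairV_le (h : DriftStep φ c ε bV cV C V P ν L) {z : X × X} (hz : z ∈ C ×ˢ C) :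
    ∫ y, (pairV V y - 1) ∂L z ≤ 2 * ((bV + cV) / (1 - ε) - 1) := by
  have := h.prob_ν
  have := h.markov_L
  have hle := (h.coupling.integral_add_le h.minor_mem h.one_le_V h.integrable_V z).2 hz
  have hi := h.coupling.integrable h.minor_mem h.integrable_V z
  have hadd : Integrable (fun y => V y.1 + V y.2) (L z) := hi.1.add hi.2
  have e : ∀ y : X × X, pairV V y - 1 = V y.1 + V y.2 - 2 := fun y => by unfold pairV; ring
  simp only [e]
  rw [integral_sub hadd (integrable_const _)]
  have d1 := h.drift z.1
  have d2 := h.drift z.2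
  have p1 := h.driftFun.pos _ (h.one_le_V z.1)
  have p2 := h.driftFun.pos _ (h.one_le_V z.2)
  have i1 := h.inside _ hz.1
  have i2 := h.inside _ hz.2
  simp only [Set.indicator_of_mem hz.1, Set.indicator_of_mem hz.2, Pi.one_apply] at d1 d2
  have hε : 0 < 1 - ε := by linarith [h.minor_mem.2]
  have : ∫ y, (V y.1 + V y.2) ∂L z ≤ 2 * (bV + cV) / (1 - ε) := by
    rw [le_div_iff₀ hε]
    linarith
  simp only [integral_const, probReal_univ, smul_eq_mul]
  rw [mul_div_assoc] at this
  linarith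

lemma measurable_lyap (h : DriftStep φ c ε bV cV C V P ν L) (k : ℕ) :
    Measurable fun y => lyap φ c k (pairV V y) :=
  measurable_comp_of_monotoneOn (h.driftFun.lyap_mono h.rate_mem.1.le k)
    (measurable_pairV h.measurable_V) (one_le_pairV h.one_le_V)

lemma integrable_lyap (h : DriftStep φ c ε bV cV C V P ν L) (k : ℕ) (z : X × X) :
    Integrable (fun y => lyap φ c k (pairV V y)) (L z) := by
  have := h.markov_L
  refine integrable_of_abs_le_add_mul (h.integrable_pairV z) (h.measurable_lyap k)
    (a := - rate φ c k) (b := rate φ c k) fun y => ?_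
  have hy := one_le_pairV h.one_le_V y
  rw [abs_of_nonneg (h.driftFun.lyap_nonneg h.rate_mem.1.le k hy)]
  linarith [h.driftFun.lyap_le h.rate_mem.1.le k hy]

lemma lyap_drift (h : DriftStep φ c ε bV cV C V P ν L) (k : ℕ) (z : X × X) :
    survival C ε z * ∫ y, lyap φ c (k + 1) (pairV V y) ∂L z ≤
      lyap φ c k (pairV V z) - c * φ 1 * rate φ c k +
        2 * bV * rate φ c (k + 1) * (C ×ˢ C).indicator 1 z := by
  have := h.markov_L
  have hc := h.rate_mem.1.le
  have hφ := h.driftFun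
  have hz := one_le_pairV h.one_le_V z
  set v := pairV V z with hv
  set s := lyapSlope φ c (k + 1) v with hs
  set α := lyap φ c (k + 1) v - s * (v - 1) with hα
  have hs0 : 0 ≤ s := hφ.lyapSlope_nonneg hc _ hz
  have hs1 : s ≤ rate φ c (k + 1) := hφ.lyapSlope_le hc _ hz
  have hα0 : 0 ≤ α := by
    have := hφ.lyap_le_tangent hc (k + 1) hz le_rfl
    rw [IsDriftFun.lyap_one] at this
    linarith
  have hint : Integrable (fun y => pairV V y - 1) (L z) :=
    (h.integrable_pairV z).sub (integrable_const 1)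
  have h1 : ∫ y, lyap φ c (k + 1) (pairV V y) ∂L z ≤ α + s * ∫ y, (pairV V y - 1) ∂L z := by
    calc _ ≤ ∫ y, (α + s * (pairV V y - 1)) ∂L z := by
          refine integral_mono (h.integrable_lyap _ z)
            ((integrable_const α).add (hint.const_mul s)) fun y => ?_
          have := hφ.lyap_le_tangent hc (k + 1) hz (one_le_pairV h.one_le_V y)
          simp only
          linarith
      _ = _ := by
          rw [integral_add (integrable_const α) (hint.const_mul s), integral_const_mul]
          simp
  have h2 := mul_le_mul_of_nonneg_left h1 (survival_nonneg (C := C) h.minor_mem.2.le z)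
  have h3 := mul_le_mul_of_nonneg_left (h.pairV_drift z) hs0
  have h4 := mul_le_mul_of_nonneg_right (survival_le_one (C := C) h.minor_mem.1.le z) hα0
  have h5 := hφ.lyap_succ_le hc k hz
  have h6 := mul_le_mul_of_nonneg_left
    (hφ.add_sub_one_le (h.one_le_V z.1) (h.one_le_V z.2)) (mul_nonneg hs0 hc)
  have hI : 0 ≤ 2 * bV * (C ×ˢ C).indicator (1 : X × X → ℝ) z :=
    mul_nonneg (by linarith [h.bV_pos]) (Set.indicator_nonneg (fun _ _ => zero_le_one) _)
  have h7 := mul_le_mul_of_nonneg_right hs1 hI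
  change s * c * φ v ≤ _ at h6
  rw [← hv] at h3
  linarith

end DriftStep

end Drift

section Accumulation

variable {Z : Type*} [MeasurableSpace Z]

/-- One step of the sub-Markov dynamics with survival probability `w` and conditional moves `κ`. -/
noncomputable def killStep (w : Z → ℝ) (κ : Kernel Z Z) (g : Z → ENNReal) (z : Z) : ENNReal :=
  ENNReal.ofReal (w z) * ∫⁻ y, g y ∂κ z

/-- The expectation, started at time `m`, of `g` at time `m + n` on survival. -/
noncomputable def survIter (w : Z → ℝ) (L : ℕ → Kernel Z Z) (g : Z → ENNReal) :
    ℕ → ℕ → Z → ENNReal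
  | 0, _ => g
  | n + 1, m => killStep w (L (m + 1)) (survIter w L g n (m + 1))

/-- The expected cost accumulated on survival over the times `m, …, m + N - 1`. -/
noncomputable def accum (w : Z → ℝ) (L : ℕ → Kernel Z Z) (g : ℕ → Z → ENNReal) :
    ℕ → ℕ → Z → ENNReal
  | 0, _ => 0
  | N + 1, m => fun z => g m z + killStep w (L (m + 1)) (accum w L g N (m + 1)) z

variable {w : Z → ℝ} {L : ℕ → Kernel Z Z}

lemma killStep_mono {κ : Kernel Z Z} {g g' : Z → ENNReal} (h : ∀ y, g y ≤ g' y) (z : Z) :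
    killStep w κ g z ≤ killStep w κ g' z := by
  unfold killStep
  gcongr with y
  exact h y

lemma killStep_const_mul {κ : Kernel Z Z} {K : ENNReal} (hK : K ≠ ⊤) (g : Z → ENNReal) (z : Z) :
    killStep w κ (fun y => K * g y) z = K * killStep w κ g z := by
  unfold killStep
  rw [lintegral_const_mul' _ _ hK]
  ring

lemma killStep_ofReal {κ : Kernel Z Z} {z : Z} (hw : 0 ≤ w z) {h : Z → ℝ}
    (hh : Integrable h (κ z)) (h0 : ∀ y, 0 ≤ h y) :
    killStep w κ (fun y => ENNReal.ofReal (h y)) z = ENNReal.ofReal (w z * ∫ y, h y ∂κ z) := by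
  unfold killStep
  rw [← ofReal_integral_eq_lintegral_ofReal hh (Eventually.of_forall h0), ENNReal.ofReal_mul hw]

lemma killStep_le_ofReal {κ : Kernel Z Z} [IsMarkovKernel κ] {g : Z → ENNReal} {z : Z}
    (hw : 0 ≤ w z) {h : Z → ℝ} (hh : Integrable h (κ z)) (h0 : ∀ y, 0 ≤ h y) {α β η : ℝ}
    (hα : 0 ≤ α) (hβ : 0 ≤ β) (hg : ∀ y, g y ≤ ENNReal.ofReal (α + β * h y))
    (hη : w z * ∫ y, h y ∂κ z ≤ η) :
    killStep w κ g z ≤ ENNReal.ofReal (w z * α + β * η) := by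
  refine (killStep_mono hg z).trans ?_
  have hint : Integrable (fun y => α + β * h y) (κ z) :=
    (integrable_const α).add (hh.const_mul β)
  rw [killStep_ofReal hw hint fun y => add_nonneg hα (mul_nonneg hβ (h0 y)),
    integral_add (integrable_const α) (hh.const_mul β), integral_const_mul]
  refine ENNReal.ofReal_le_ofReal ?_
  simp only [integral_const, probReal_univ, smul_eq_mul, one_mul]
  nlinarith

lemma measurable_survIter (hw : Measurable w) {g : Z → ENNReal} (hg : Measurable g) (n m : ℕ) :
    Measurable (survIter w L g n m) := by
  induction n generalizing m with
  | zero => exact hg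
  | succ n ih => exact hw.ennreal_ofReal.mul (ih (m + 1)).lintegral_kernel

lemma sum_survIter (hw : Measurable w) {g : Z → ENNReal} (hg : Measurable g) (b : ℕ → ENNReal)
    (N m : ℕ) (z : Z) :
    ∑ n ∈ Finset.range N, b (m + n) * survIter w L g n m z =
      accum w L (fun k z => b k * g z) N m z := by
  induction N generalizing m z with
  | zero => simp [accum]
  | succ N ih =>
    rw [Finset.sum_range_succ', add_comm]
    simp only [accum, survIter, add_zero, killStep]
    simp_rw [← ih]
    rw [lintegral_finsetSum _ fun n _ => (measurable_survIter hw hg n (m + 1)).const_mul _,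
      Finset.mul_sum]
    congr 1
    refine Finset.sum_congr rfl fun n _ => ?_
    rw [lintegral_const_mul _ (measurable_survIter hw hg n (m + 1)), show m + 1 + n = m + (n + 1) by
      omega]
    ring

lemma accum_le_mul {K : ENNReal} (hK : K ≠ ⊤) {g g' : ℕ → Z → ENNReal}
    (h : ∀ k z, g k z ≤ K * g' k z) (N m : ℕ) (z : Z) :
    accum w L g N m z ≤ K * accum w L g' N m z := by
  induction N generalizing m z with
  | zero => simp [accum]
  | succ N ih =>
    simp only [accum]
    rw [mul_add, ← killStep_const_mul hK]
    exact add_le_add (h m z) (killStep_mono (ih (m + 1)) z)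

end Accumulation

section Bounds

variable {X : Type*} [MeasurableSpace X] {φ : ℝ → ℝ} {c ε bV cV : ℝ} {C : Set X} {V : X → ℝ}
  {P : ℕ → Kernel X X} {ν : ℕ → Measure X} {L : ℕ → Kernel (X × X) (X × X)}

/-- The expected value, on survival, of the sum of the rates along the visits to `C × C`. -/
noncomputable def visitSum (φ : ℝ → ℝ) (c ε : ℝ) (C : Set X) (L : ℕ → Kernel (X × X) (X × X)) :
    ℕ → ℕ → X × X → ENNReal :=
  accum (survival C ε) L
    fun k z => ENNReal.ofReal (rate φ c (k + 1) * (C ×ˢ C).indicator 1 z)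

lemma visitSum_succ (N m : ℕ) (z : X × X) :
    visitSum φ c ε C L (N + 1) m z =
      ENNReal.ofReal (rate φ c (m + 1) * (C ×ˢ C).indicator 1 z) +
        killStep (survival C ε) (L (m + 1)) (visitSum φ c ε C L N (m + 1)) z := rfl

/-- An upper bound for the expected rate just after the next visit to `C × C`. -/
noncomputable def returnBound (φ : ℝ → ℝ) (c : ℝ) (C : Set X) (V : X → ℝ) (m : ℕ) (z : X × X) :
    ℝ :=
  rate φ c (m + 1) + deltaSeq φ c (m + 1) / (c * φ 1) *
    (C ×ˢ C)ᶜ.indicator (fun z => lyap φ c (m + 2) (pairV V z)) z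

lemma rate_return_le (hφ : IsDriftFun φ) (hc : 0 < c) (hB : 0 ≤ (bV + cV) / (1 - ε) - 1)
    {m j : ℕ} (hj : j ≤ m + 1) :
    rate φ c (m + 2) + deltaSeq φ c (m + 1) / (c * φ 1) * rate φ c (m + 3) *
        (2 * ((bV + cV) / (1 - ε) - 1)) ≤
      (1 + deltaSeq φ c j * Mone φ c ε bV cV) * rate φ c (m + 1) := by
  have h1 := hφ.pos 1 le_rfl
  have hr1 := hφ.one_le_rate hc.le 1
  have hr := hφ.one_le_rate hc.le (m + 1)
  have hd := hφ.deltaSeq_nonneg hc.le (m + 1)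
  have hdj := hφ.deltaSeq_antitone hc.le hj
  have e2 := hφ.rate_succ_le_mul hc.le (m + 1)
  have e3 := hφ.rate_succ_le_mul hc.le (m + 2)
  have ea := hφ.rate_succ_le_add hc.le (m + 1)
  simp only [add_assoc, Nat.reduceAdd] at e2 e3 ea
  set B := (bV + cV) / (1 - ε) - 1
  set r1 := rate φ c 1
  have e4 : rate φ c (m + 3) ≤ rate φ c (m + 1) * r1 * r1 := by nlinarith
  have hM : Mone φ c ε bV cV = r1 + r1 * r1 / (c * φ 1) * (2 * B) := by
    unfold Mone
    ring
  have hcφ : 0 < c * φ 1 := mul_pos hc h1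
  have hM0 : 0 ≤ Mone φ c ε bV cV := by rw [hM]; positivity
  calc _ ≤ rate φ c (m + 1) + deltaSeq φ c (m + 1) * (rate φ c (m + 1) * r1) +
        deltaSeq φ c (m + 1) / (c * φ 1) * (rate φ c (m + 1) * r1 * r1) * (2 * B) := by
        gcongr
        exact ea.trans (by gcongr)
    _ = (1 + deltaSeq φ c (m + 1) * Mone φ c ε bV cV) * rate φ c (m + 1) := by
        rw [hM]; ring
    _ ≤ _ := by gcongr

/-- The factors of the product in `cstar`. -/
noncomputable def growth (φ : ℝ → ℝ) (c ε bV cV : ℝ) (k : ℕ) : ℝ :=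
  1 + deltaSeq φ c k * Mone φ c ε bV cV

lemma Mone_nonneg (hφ : IsDriftFun φ) (hc : 0 < c) (hB : 0 ≤ (bV + cV) / (1 - ε) - 1) :
    0 ≤ Mone φ c ε bV cV := by
  have h1 := hφ.pos 1 le_rfl
  have hr := zero_le_one.trans (hφ.one_le_rate hc.le 1)
  unfold Mone
  positivity

lemma one_le_growth (hφ : IsDriftFun φ) (hc : 0 < c) (hB : 0 ≤ (bV + cV) / (1 - ε) - 1) (k : ℕ) :
    1 ≤ growth φ c ε bV cV k :=
  le_add_of_nonneg_right (mul_nonneg (hφ.deltaSeq_nonneg hc.le k) (Mone_nonneg hφ hc hB))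

lemma cstar_nonneg (hφ : IsDriftFun φ) (hc : 0 < c) (hε : ε ≤ 1)
    (hB : 0 ≤ (bV + cV) / (1 - ε) - 1) : 0 ≤ cstar φ c ε bV cV :=
  tsum_nonneg fun _ => mul_nonneg (pow_nonneg (sub_nonneg.2 hε) _)
    (Finset.prod_nonneg fun k _ => zero_le_one.trans (one_le_growth hφ hc hB k))

lemma visitSum_le_returnBound
    (hD : ∀ k, DriftStep φ c ε bV cV C V (P (k + 1)) (ν (k + 1)) (L (k + 1)))
    (hB : 0 ≤ (bV + cV) / (1 - ε) - 1) (N : ℕ) {m j : ℕ} (hj : j ≤ m + 1) (z : X × X) :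
    visitSum φ c ε C L N m z ≤ ENNReal.ofReal
      (cpartial (1 - ε) (growth φ c ε bV cV) N j * returnBound φ c C V m z) := by
  induction N generalizing m j z with
  | zero => simp [visitSum, accum]
  | succ N ih =>
    have hφ := (hD 0).driftFun
    have hc := (hD 0).rate_mem.1
    have hε := (hD 0).minor_mem
    have hq : 0 ≤ 1 - ε := by linarith [hε.2]
    have hV1 := (hD 0).one_le_V
    have := (hD m).markov_L
    have hg : ∀ k, 0 ≤ growth φ c ε bV cV k := fun k =>
      zero_le_one.trans (one_le_growth hφ hc hB k)
    have hcφ : 0 < c * φ 1 := mul_pos hc (hφ.pos 1 le_rfl)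
    have hr : ∀ k, 0 ≤ rate φ c k := fun k => zero_le_one.trans (hφ.one_le_rate hc.le k)
    have hd := hφ.deltaSeq_nonneg hc.le (m + 1)
    have hN : ∀ i, 0 ≤ cpartial (1 - ε) (growth φ c ε bV cV) N i := fun i =>
      cpartial_nonneg hq hg N i
    have hl : ∀ k (y : X × X), 0 ≤ lyap φ c k (pairV V y) := fun k y =>
      hφ.lyap_nonneg hc.le k (one_le_pairV hV1 y)
    have hret : ∀ y, returnBound φ c C V (m + 1) y ≤
        rate φ c (m + 2) + deltaSeq φ c (m + 1) / (c * φ 1) * lyap φ c (m + 3) (pairV V y) := by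
      intro y
      unfold returnBound
      gcongr
      · exact Set.indicator_nonneg (fun _ _ => hl _ _) _
      · exact hφ.deltaSeq_antitone hc.le (by omega)
      · exact Set.indicator_le_self' (fun _ _ => hl _ _) _
    rw [visitSum_succ]
    by_cases hz : z ∈ C ×ˢ C
    · have hkill := killStep_le_ofReal (κ := L (m + 1)) (w := survival C ε) (z := z)
        (g := visitSum φ c ε C L N (m + 1)) (survival_nonneg hε.2.le z)
        (((hD m).integrable_pairV z).sub (integrable_const 1))
        (fun y => by simpa using one_le_pairV hV1 y)
        (α := cpartial (1 - ε) (growth φ c ε bV cV) N (j + 1) * rate φ c (m + 2))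
        (β := cpartial (1 - ε) (growth φ c ε bV cV) N (j + 1) *
          (deltaSeq φ c (m + 1) / (c * φ 1) * rate φ c (m + 3)))
        (mul_nonneg (hN _) (hr _))
        (mul_nonneg (hN _) (mul_nonneg (div_nonneg hd hcφ.le) (hr _)))
        (fun y => (ih (j := j + 1) (by omega) y).trans (ENNReal.ofReal_le_ofReal ?_))
        (mul_le_mul_of_nonneg_left ((hD m).integral_pairV_le hz) (survival_nonneg hε.2.le z))
      · rw [survival_of_mem hz] at hkill
        refine (add_le_add le_rfl hkill).trans ?_
        simp only [Set.indicator_of_mem hz, Pi.one_apply, mul_one]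
        rw [← ENNReal.ofReal_add (hr _) (by
          have := hN (j + 1); have := hr (m + 2); have := hr (m + 3); positivity)]
        refine ENNReal.ofReal_le_ofReal ?_
        have hrl := mul_le_mul_of_nonneg_left (rate_return_le hφ hc hB hj)
          (mul_nonneg hq (hN (j + 1)))
        have : returnBound φ c C V m z = rate φ c (m + 1) := by simp [returnBound, hz]
        rw [this, cpartial_succ]
        change _ ≤ _ * (growth φ c ε bV cV j * _) at hrl
        linarith
      · have h1 := mul_le_mul_of_nonneg_left (hret y) (hN (j + 1))
        have h2 := mul_le_mul_of_nonneg_left (hφ.lyap_le hc.le (m + 3) (one_le_pairV hV1 y))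
          (mul_nonneg (hN (j + 1)) (div_nonneg hd hcφ.le))
        simp only [Pi.sub_apply]
        linarith
    · have hdr := (hD m).lyap_drift (m + 2) z
      simp only [Set.indicator_of_notMem hz, mul_zero, add_zero] at hdr
      have hkill := killStep_le_ofReal (κ := L (m + 1)) (w := survival C ε) (z := z)
        (g := visitSum φ c ε C L N (m + 1)) (survival_nonneg hε.2.le z)
        ((hD m).integrable_lyap (m + 3) z) (fun y => hl _ y)
        (α := cpartial (1 - ε) (growth φ c ε bV cV) N j * rate φ c (m + 2))
        (β := cpartial (1 - ε) (growth φ c ε bV cV) N j * (deltaSeq φ c (m + 1) / (c * φ 1)))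
        (mul_nonneg (hN _) (hr _))
        (mul_nonneg (hN _) (div_nonneg hd hcφ.le))
        (fun y => (ih (j := j) (by omega) y).trans (ENNReal.ofReal_le_ofReal ?_)) hdr
      · rw [survival_of_notMem hz] at hkill
        simp only [Set.indicator_of_notMem hz, mul_zero, ENNReal.ofReal_zero, zero_add]
        refine hkill.trans (ENNReal.ofReal_le_ofReal ?_)
        have hret0 : returnBound φ c C V m z = rate φ c (m + 1) +
            deltaSeq φ c (m + 1) / (c * φ 1) * lyap φ c (m + 2) (pairV V z) := by
          simp [returnBound, hz]
        have hadd := hφ.rate_succ_le_add hc.le (m + 1)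
        have hR : 0 ≤ returnBound φ c C V m z := by
          rw [hret0]
          exact add_nonneg (hr _) (mul_nonneg (div_nonneg hd hcφ.le) (hl _ _))
        refine le_trans ?_ (mul_le_mul_of_nonneg_right (cpartial_le_succ hq hg N j) hR)
        have e : deltaSeq φ c (m + 1) / (c * φ 1) * (c * φ 1 * rate φ c (m + 2)) =
            deltaSeq φ c (m + 1) * rate φ c (m + 2) := by
          rw [← mul_assoc, div_mul_cancel₀ _ hcφ.ne']
        rw [hret0, one_mul, mul_assoc, ← mul_add]
        refine mul_le_mul_of_nonneg_left ?_ (hN j)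
        rw [mul_sub, e]
        linarith
      · have h1 := mul_le_mul_of_nonneg_left (hret y) (hN j)
        linarith

/-- An upper bound for the expected rate at the next visit to `C × C`. -/
noncomputable def visitBound (φ : ℝ → ℝ) (c : ℝ) (C : Set X) (V : X → ℝ) (m : ℕ) (z : X × X) : ℝ :=
  (C ×ˢ C).indicator (fun _ => rate φ c (m + 1)) z +
    (C ×ˢ C)ᶜ.indicator (fun z => rate φ c 1 ^ 2 / (c * φ 1) * lyap φ c m (pairV V z)) z

lemma visitSum_le_visitBound
    (hD : ∀ k, DriftStep φ c ε bV cV C V (P (k + 1)) (ν (k + 1)) (L (k + 1)))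
    (hB : 0 ≤ (bV + cV) / (1 - ε) - 1) (N m : ℕ) (z : X × X) :
    visitSum φ c ε C L N m z ≤ ENNReal.ofReal
      (cpartial (1 - ε) (growth φ c ε bV cV) N 1 * visitBound φ c C V m z) := by
  induction N generalizing m z with
  | zero => simp [visitSum, accum]
  | succ N ih =>
    by_cases hz : z ∈ C ×ˢ C
    · have hv : visitBound φ c C V m z = returnBound φ c C V m z := by
        simp [visitBound, returnBound, hz]
      rw [hv]
      exact visitSum_le_returnBound hD hB _ (by omega) z
    · have hφ := (hD 0).driftFun
      have hc := (hD 0).rate_mem.1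
      have hε := (hD 0).minor_mem
      have hq : 0 ≤ 1 - ε := by linarith [hε.2]
      have := (hD m).markov_L
      have hg : ∀ k, 0 ≤ growth φ c ε bV cV k := fun k =>
        zero_le_one.trans (one_le_growth hφ hc hB k)
      have hcφ : 0 < c * φ 1 := mul_pos hc (hφ.pos 1 le_rfl)
      have hr : ∀ k, 0 ≤ rate φ c k := fun k => zero_le_one.trans (hφ.one_le_rate hc.le k)
      have hN := cpartial_nonneg hq hg N 1
      have hl : ∀ k (y : X × X), 0 ≤ lyap φ c k (pairV V y) := fun k y =>
        hφ.lyap_nonneg hc.le k (one_le_pairV (hD 0).one_le_V y)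
      have hb : 0 ≤ rate φ c 1 ^ 2 / (c * φ 1) := div_nonneg (sq_nonneg _) hcφ.le
      have hdr := (hD m).lyap_drift m z
      simp only [Set.indicator_of_notMem hz, mul_zero, add_zero] at hdr
      have hkill := killStep_le_ofReal (κ := L (m + 1)) (w := survival C ε) (z := z)
        (g := visitSum φ c ε C L N (m + 1)) (survival_nonneg hε.2.le z)
        ((hD m).integrable_lyap (m + 1) z) (fun y => hl _ y)
        (α := cpartial (1 - ε) (growth φ c ε bV cV) N 1 * rate φ c (m + 2))
        (β := cpartial (1 - ε) (growth φ c ε bV cV) N 1 * (rate φ c 1 ^ 2 / (c * φ 1)))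
        (mul_nonneg hN (hr _)) (mul_nonneg hN hb)
        (fun y => (ih (m + 1) y).trans (ENNReal.ofReal_le_ofReal ?_)) hdr
      · rw [survival_of_notMem hz] at hkill
        rw [visitSum_succ]
        simp only [Set.indicator_of_notMem hz, mul_zero, ENNReal.ofReal_zero, zero_add]
        refine hkill.trans (ENNReal.ofReal_le_ofReal ?_)
        have hv : visitBound φ c C V m z =
            rate φ c 1 ^ 2 / (c * φ 1) * lyap φ c m (pairV V z) := by simp [visitBound, hz]
        have hV0 : 0 ≤ visitBound φ c C V m z := hv ▸ mul_nonneg hb (hl _ _)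
        refine le_trans ?_ (mul_le_mul_of_nonneg_right (cpartial_le_succ hq hg N 1) hV0)
        have e1 := hφ.rate_succ_le_mul hc.le m
        have e2 := hφ.rate_succ_le_mul hc.le (m + 1)
        have e3 : rate φ c (m + 2) ≤ rate φ c 1 ^ 2 * rate φ c m := by
          have := mul_le_mul_of_nonneg_right e1 (hr 1)
          simp only [add_assoc, Nat.reduceAdd] at e2
          linarith
        have e : rate φ c 1 ^ 2 / (c * φ 1) * (c * φ 1 * rate φ c m) =
            rate φ c 1 ^ 2 * rate φ c m := by
          rw [← mul_assoc, div_mul_cancel₀ _ hcφ.ne']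
        rw [hv, one_mul, mul_assoc, ← mul_add]
        refine mul_le_mul_of_nonneg_left ?_ hN
        rw [mul_sub, e]
        linarith
      · rw [mul_assoc, ← mul_add]
        refine mul_le_mul_of_nonneg_left (add_le_add ?_ ?_) hN
        · exact Set.indicator_le_self' (fun _ _ => hr _) _
        · exact Set.indicator_le_self' (fun _ _ => mul_nonneg hb (hl _ _)) _

lemma visitSum_zero_le
    (hD : ∀ k, DriftStep φ c ε bV cV C V (P (k + 1)) (ν (k + 1)) (L (k + 1)))
    (hB : 0 ≤ (bV + cV) / (1 - ε) - 1) (hd : Tendsto (deriv φ) atTop (nhds 0)) (N : ℕ)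
    (z : X × X) :
    visitSum φ c ε C L N 0 z ≤ ENNReal.ofReal
      (cstar φ c ε bV cV * (rate φ c 1 * (1 + rate φ c 1 / (c * φ 1))) * pairV V z) := by
  have hφ := (hD 0).driftFun
  have hc := (hD 0).rate_mem.1
  have hε := (hD 0).minor_mem
  have hv := one_le_pairV (hD 0).one_le_V z
  have hcφ : 0 < c * φ 1 := mul_pos hc (hφ.pos 1 le_rfl)
  have hr := zero_le_one.trans (hφ.one_le_rate hc.le 1)
  refine (visitSum_le_visitBound hD hB N 0 z).trans (ENNReal.ofReal_le_ofReal ?_)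
  have hlim : Tendsto (growth φ c ε bV cV) atTop (nhds 1) := by
    have := ((hφ.tendsto_deltaSeq hc hd).mul_const (Mone φ c ε bV cV)).const_add 1
    rwa [zero_mul, add_zero] at this
  have hg := one_le_growth hφ hc hB
  have h1 : cpartial (1 - ε) (growth φ c ε bV cV) N 1 ≤ cstar φ c ε bV cV :=
    cpartial_one_le_tsum (by linarith [hε.2]) (by linarith [hε.1])
      (fun k => zero_lt_one.trans_le (hg k)) hlim N
  have h0 := cpartial_nonneg (by linarith [hε.2]) (fun k => zero_le_one.trans (hg k)) N 1
    (q := 1 - ε)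
  rw [mul_assoc]
  have hk : 0 ≤ rate φ c 1 * (rate φ c 1 / (c * φ 1)) := by positivity
  have h2 : visitBound φ c C V 0 z ≤ rate φ c 1 * (1 + rate φ c 1 / (c * φ 1)) * pairV V z := by
    by_cases hz : z ∈ C ×ˢ C
    · have : visitBound φ c C V 0 z = rate φ c 1 := by simp [visitBound, hz]
      rw [this]
      nlinarith
    · have : visitBound φ c C V 0 z = rate φ c 1 * (rate φ c 1 / (c * φ 1)) * (pairV V z - 1) := by
        simp only [visitBound, hz, not_false_eq_true, Set.indicator_of_notMem, zero_add,
          Set.mem_compl_iff, Set.indicator_of_mem, hφ.lyap_zero hv]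
        ring
      rw [this]
      nlinarith
  refine mul_le_mul h1 h2 ?_ (h0.trans h1)
  exact add_nonneg (Set.indicator_nonneg (fun _ _ => hr) _)
    (Set.indicator_nonneg (fun y _ => mul_nonneg (by positivity)
      (hφ.lyap_nonneg hc.le 0 (one_le_pairV (hD 0).one_le_V y))) _)

/-- The total cost, which bounds the weighted differences of the two marginals. -/
noncomputable def costSum (φ : ℝ → ℝ) (c ε : ℝ) (C : Set X) (V : X → ℝ)
    (L : ℕ → Kernel (X × X) (X × X)) : ℕ → ℕ → X × X → ENNReal :=
  accum (survival C ε) L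
    fun k z => ENNReal.ofReal (2 * rate φ c k + (φ (V z.1) + φ (V z.2)) / φ 1)

/-- The part of the bound on `costSum` which does not depend on the visits to `C × C`. -/
noncomputable def costPotential (φ : ℝ → ℝ) (c ε bV : ℝ) (V : X → ℝ) (m : ℕ) (z : X × X) : ℝ :=
  2 / (c * φ 1) * lyap φ c m (pairV V z) + 1 / (c * φ 1) * (pairV V z - 1) +
    2 * bV / (ε * (c * φ 1))

lemma costPotential_nonneg
    (hD : ∀ k, DriftStep φ c ε bV cV C V (P (k + 1)) (ν (k + 1)) (L (k + 1))) (m : ℕ)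
    (z : X × X) : 0 ≤ costPotential φ c ε bV V m z := by
  have hφ := (hD 0).driftFun
  have hc := (hD 0).rate_mem.1
  have hε := (hD 0).minor_mem.1
  have hb := (hD 0).bV_pos
  have hv := one_le_pairV (hD 0).one_le_V z
  have hl := hφ.lyap_nonneg hc.le m hv
  have h1 := hφ.pos 1 le_rfl
  have := sub_nonneg.2 hv
  unfold costPotential
  positivity

lemma costSum_le_add_visitSum
    (hD : ∀ k, DriftStep φ c ε bV cV C V (P (k + 1)) (ν (k + 1)) (L (k + 1))) (N m : ℕ)
    (z : X × X) :
    costSum φ c ε C V L N m z ≤ ENNReal.ofReal (costPotential φ c ε bV V m z) +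
      ENNReal.ofReal (4 * bV / (c * φ 1)) * visitSum φ c ε C L N m z := by
  induction N generalizing m z with
  | zero => simp [costSum, visitSum, accum]
  | succ N ih =>
    have hφ := (hD 0).driftFun
    have hc := (hD 0).rate_mem.1
    have hε := (hD 0).minor_mem
    have hb := (hD 0).bV_pos
    have hV1 := (hD 0).one_le_V
    have hmk := (hD m).markov_L
    have h1 := hφ.pos 1 le_rfl
    have hcφ : 0 < c * φ 1 := mul_pos hc h1
    have hr : ∀ k, 0 ≤ rate φ c k := fun k => zero_le_one.trans (hφ.one_le_rate hc.le k)
    have hT := costPotential_nonneg hD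
    have hmT : Measurable (costPotential φ c ε bV V (m + 1)) :=
      ((((hD m).measurable_lyap (m + 1)).const_mul _).add
        (((measurable_pairV (hD m).measurable_V).sub_const 1).const_mul _)).add_const _
    have hw := survival_nonneg (C := C) hε.2.le z
    have hi1 := ((hD m).integrable_lyap (m + 1) z).const_mul (2 / (c * φ 1))
    have hi2 : Integrable (fun y => 1 / (c * φ 1) * (pairV V y - 1)) (L (m + 1) z) :=
      (((hD m).integrable_pairV z).sub (integrable_const 1)).const_mul _
    have hi12 : Integrable (fun y => 2 / (c * φ 1) * lyap φ c (m + 1) (pairV V y) +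
        1 / (c * φ 1) * (pairV V y - 1)) (L (m + 1) z) := hi1.add hi2
    have hiT : Integrable (costPotential φ c ε bV V (m + 1)) (L (m + 1) z) :=
      hi12.add (integrable_const _)
    have heT : ∫ y, costPotential φ c ε bV V (m + 1) y ∂L (m + 1) z =
        2 / (c * φ 1) * ∫ y, lyap φ c (m + 1) (pairV V y) ∂L (m + 1) z +
          1 / (c * φ 1) * ∫ y, (pairV V y - 1) ∂L (m + 1) z + 2 * bV / (ε * (c * φ 1)) := by
      unfold costPotential
      rw [integral_add hi12 (integrable_const _), integral_add hi1 hi2, integral_const_mul,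
        integral_const_mul]
      simp
    have hkill : killStep (survival C ε) (L (m + 1)) (costSum φ c ε C V L N (m + 1)) z ≤
        ENNReal.ofReal (survival C ε z * ∫ y, costPotential φ c ε bV V (m + 1) y ∂L (m + 1) z) +
          ENNReal.ofReal (4 * bV / (c * φ 1)) *
            killStep (survival C ε) (L (m + 1)) (visitSum φ c ε C L N (m + 1)) z := by
      refine (killStep_mono (ih (m + 1)) z).trans (le_of_eq ?_)
      rw [← killStep_const_mul ENNReal.ofReal_ne_top, ← killStep_ofReal hw hiT (hT _)]
      unfold killStep
      rw [lintegral_add_left hmT.ennreal_ofReal, mul_add]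
    change _ + killStep (survival C ε) (L (m + 1)) (costSum φ c ε C V L N (m + 1)) z ≤ _
    refine (add_le_add le_rfl hkill).trans ?_
    rw [visitSum_succ, mul_add, ← add_assoc, ← add_assoc]
    refine add_le_add ?_ le_rfl
    have hI0 : 0 ≤ (C ×ˢ C).indicator (1 : X × X → ℝ) z :=
      Set.indicator_nonneg (fun _ _ => zero_le_one) _
    have hp : 0 ≤ (φ (V z.1) + φ (V z.2)) / φ 1 :=
      div_nonneg (add_nonneg (hφ.pos _ (hV1 _)).le (hφ.pos _ (hV1 _)).le) h1.le
    rw [← ENNReal.ofReal_mul (by positivity), ← ENNReal.ofReal_add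
      (add_nonneg (mul_nonneg zero_le_two (hr m)) hp)
      (mul_nonneg hw (integral_nonneg (hT _))),
      ← ENNReal.ofReal_add (hT _ _) (mul_nonneg (by positivity) (mul_nonneg (hr _) hI0))]
    refine ENNReal.ofReal_le_ofReal ?_
    have d1 := mul_le_mul_of_nonneg_left ((hD m).lyap_drift m z)
      (show 0 ≤ 2 / (c * φ 1) by positivity)
    have d2 := mul_le_mul_of_nonneg_left ((hD m).pairV_drift z)
      (show 0 ≤ 1 / (c * φ 1) by positivity)
    have e : (2 * rate φ c m + (φ (V z.1) + φ (V z.2)) / φ 1) +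
        (2 / (c * φ 1) * (lyap φ c m (pairV V z) - c * φ 1 * rate φ c m +
          2 * bV * rate φ c (m + 1) * (C ×ˢ C).indicator 1 z) +
        1 / (c * φ 1) * (pairV V z - 1 - c * (φ (V z.1) + φ (V z.2)) +
          2 * bV * (C ×ˢ C).indicator 1 z) +
        survival C ε z * (2 * bV / (ε * (c * φ 1)))) =
        costPotential φ c ε bV V m z +
          4 * bV / (c * φ 1) * (rate φ c (m + 1) * (C ×ˢ C).indicator 1 z) := by
      have := hε.1.ne'
      unfold costPotential survival
      field_simp
      ring
    rw [← e, heT]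
    linarith

lemma costSum_zero_le
    (hD : ∀ k, DriftStep φ c ε bV cV C V (P (k + 1)) (ν (k + 1)) (L (k + 1)))
    (hB : 0 ≤ (bV + cV) / (1 - ε) - 1) (hd : Tendsto (deriv φ) atTop (nhds 0)) (N : ℕ)
    (z : X × X) :
    costSum φ c ε C V L N 0 z ≤ ENNReal.ofReal (cconst φ c ε bV cV * pairV V z) := by
  have hφ := (hD 0).driftFun
  have hc := (hD 0).rate_mem.1
  have hε := (hD 0).minor_mem
  have hb := (hD 0).bV_pos
  have hv := one_le_pairV (hD 0).one_le_V z
  have hcφ : 0 < c * φ 1 := mul_pos hc (hφ.pos 1 le_rfl)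
  have hr := zero_le_one.trans (hφ.one_le_rate hc.le 1)
  have hS := cstar_nonneg hφ hc hε.2.le hB
  set R := cstar φ c ε bV cV * (rate φ c 1 * (1 + rate φ c 1 / (c * φ 1))) with hR
  have hR0 : 0 ≤ R := by positivity
  refine (costSum_le_add_visitSum hD N 0 z).trans ?_
  refine (add_le_add le_rfl (mul_le_mul_right (visitSum_zero_le hD hB hd N z) _)).trans ?_
  rw [← ENNReal.ofReal_mul (by positivity), ← ENNReal.ofReal_add
    (costPotential_nonneg hD 0 z)
    (mul_nonneg (by positivity) (mul_nonneg hR0 (zero_le_one.trans hv)))]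
  refine ENNReal.ofReal_le_ofReal ?_
  have e1 : costPotential φ c ε bV V 0 z =
      2 / (c * φ 1) * (3 / 2 * (pairV V z - 1) + bV / ε) := by
    have := hε.1.ne'
    rw [costPotential, hφ.lyap_zero hv]
    field_simp
    ring
  have e2 : cconst φ c ε bV cV = 2 / (c * φ 1) *
      (2 + (2 * bV + c * φ 1) / ε + (2 * bV + c * φ 1) * R) := by
    rw [hR]
    unfold cconst bbar
    ring
  have e3 : 4 * bV / (c * φ 1) * (R * pairV V z) =
      2 / (c * φ 1) * (2 * bV * R * pairV V z) := by ring
  change costPotential φ c ε bV V 0 z + 4 * bV / (c * φ 1) * (R * pairV V z) ≤ _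
  rw [e1, e2, e3, ← mul_add, mul_assoc (2 / (c * φ 1))]
  refine mul_le_mul_of_nonneg_left ?_ (by positivity)
  have f1 : bV / ε ≤ (2 * bV + c * φ 1) / ε * pairV V z := by
    have : bV / ε ≤ (2 * bV + c * φ 1) / ε := div_le_div_of_nonneg_right (by linarith) hε.1.le
    have h0 : 0 ≤ bV / ε := div_nonneg hb.le hε.1.le
    nlinarith
  have f2 : 2 * bV * R * pairV V z ≤ (2 * bV + c * φ 1) * R * pairV V z := by
    gcongr
    linarith
  linarith

lemma cconst_nonneg (hφ : IsDriftFun φ) (hc : 0 < c) (hε : ε ∈ Set.Ioo (0 : ℝ) 1) (hb : 0 ≤ bV)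
    (hB : 0 ≤ (bV + cV) / (1 - ε) - 1) : 0 ≤ cconst φ c ε bV cV := by
  have hS := cstar_nonneg hφ hc hε.2.le hB
  have h1 := hφ.pos 1 le_rfl
  have hr := zero_le_one.trans (hφ.one_le_rate hc.le 1)
  have := hε.1
  unfold cconst bbar
  positivity

end Bounds

section Iteration

variable {X : Type*} [MeasurableSpace X] {P : ℕ → Kernel X X}

instance isMarkovKernel_iterKernel [∀ k, IsMarkovKernel (P k)] (n : ℕ) :
    IsMarkovKernel (iterKernel P n) := by
  induction n with
  | zero => exact inferInstanceAs (IsMarkovKernel Kernel.id)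
  | succ n ih => exact inferInstanceAs (IsMarkovKernel ((P (n + 1)).comp (iterKernel P n)))

lemma iterKernel_succ_eq_comp (P : ℕ → Kernel X X) (n : ℕ) :
    iterKernel P (n + 1) = (iterKernel (fun k => P (k + 1)) n).comp (P 1) := by
  induction n with
  | zero => simp [iterKernel]
  | succ n ih =>
    rw [iterKernel, ih, ← Kernel.comp_assoc]
    rfl

lemma bind_iterKernel {π : Measure X} (hπ : ∀ k, π.bind (P (k + 1)) = π) (n : ℕ) :
    π.bind (iterKernel P n) = π := by
  induction n with
  | zero => exact Measure.id_comp
  | succ n ih => rw [iterKernel, ← Measure.comp_assoc, ih, hπ]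

lemma integrable_iterKernel [∀ k, IsMarkovKernel (P k)] {V : X → ℝ} (hV : Measurable V)
    (hV0 : ∀ x, 0 ≤ V x) {b : ℝ} (hi : ∀ k x, Integrable V (P (k + 1) x))
    (hb : ∀ k x, ∫ y, V y ∂P (k + 1) x ≤ V x + b) (n : ℕ) (x : X) :
    Integrable V (iterKernel P n x) := by
  induction n with
  | zero =>
    rw [iterKernel, Kernel.id_apply]
    exact integrable_dirac' hV.stronglyMeasurable (by simp)
  | succ n ih =>
    rw [iterKernel, integrable_comp_iff hV.aestronglyMeasurable]
    refine ⟨Eventually.of_forall (hi n), ?_⟩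
    refine (ih.add (integrable_const b)).mono'
      hV.norm.stronglyMeasurable.integral_kernel.aestronglyMeasurable
      (Eventually.of_forall fun y => ?_)
    simp only [Real.norm_of_nonneg (hV0 _)]
    rw [Real.norm_of_nonneg (integral_nonneg hV0)]
    exact hb n y

end Iteration

section Convergence

variable {X : Type*} [MeasurableSpace X] {φ : ℝ → ℝ} {c ε bV cV : ℝ} {C : Set X} {V : X → ℝ}
  {P : ℕ → Kernel X X} {ν : ℕ → Measure X} {L : ℕ → Kernel (X × X) (X × X)}

lemma integrable_iterKernel_of_drift [∀ k, IsMarkovKernel (P k)]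
    (hD : ∀ k, DriftStep φ c ε bV cV C V (P (k + 1)) (ν (k + 1)) (L (k + 1))) {f : X → ℝ}
    (hf : Measurable f) {a b : ℝ} (hle : ∀ x, |f x| ≤ a + b * V x) (m n : ℕ) (x : X) :
    Integrable f (iterKernel (fun k => P (m + k)) n x) := by
  have hV := (hD 0).measurable_V
  have hV1 := (hD 0).one_le_V
  refine integrable_of_abs_le_add_mul (integrable_iterKernel hV (fun x => zero_le_one.trans (hV1 x))
    (b := bV) (fun k x => (hD (m + k)).integrable_V x) (fun k x => ?_) n x) hf hle
  have h1 := (hD (m + k)).drift x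
  have h2 := (hD 0).driftFun.pos _ (hV1 x)
  have h3 : bV * C.indicator (1 : X → ℝ) x ≤ bV :=
    mul_le_of_le_one_right (hD 0).bV_pos.le (Set.indicator_le_self' (fun _ _ => zero_le_one) x)
  exact h1.trans (by linarith)

lemma ofReal_abs_integral_sub_le_survIter [∀ k, IsMarkovKernel (P k)]
    (hD : ∀ k, DriftStep φ c ε bV cV C V (P (k + 1)) (ν (k + 1)) (L (k + 1))) {f : X → ℝ}
    (hf : Measurable f) {a b : ℝ} (hle : ∀ x, |f x| ≤ a + b * V x) (n m : ℕ) (z : X × X) :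
    ENNReal.ofReal |∫ y, f y ∂iterKernel (fun k => P (m + k)) n z.1 -
        ∫ y, f y ∂iterKernel (fun k => P (m + k)) n z.2| ≤
      survIter (survival C ε) L (fun z => ENNReal.ofReal (|f z.1| + |f z.2|)) n m z := by
  induction n generalizing m z with
  | zero =>
    simp only [iterKernel, Kernel.id_apply, integral_dirac' f _ hf.stronglyMeasurable, survIter]
    exact ENNReal.ofReal_le_ofReal (abs_sub _ _)
  | succ n ih =>
    have hε := (hD 0).minor_mem
    have hshift : (fun k => P (m + (k + 1))) = fun k => P (m + 1 + k) := by
      ext1 k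
      congr 1
      omega
    have hcomp : iterKernel (fun k => P (m + k)) (n + 1) =
        (iterKernel (fun k => P (m + 1 + k)) n).comp (P (m + 1)) := by
      rw [iterKernel_succ_eq_comp, hshift]
    have hint := integrable_iterKernel_of_drift hD hf hle m (n + 1)
    rw [hcomp] at hint ⊢
    set u : X → ℝ := fun x => ∫ y, f y ∂iterKernel (fun k => P (m + 1 + k)) n x
    have hu : ∀ x, Integrable u (P (m + 1) x) := fun x => (hint x).integral_comp
    rw [Kernel.integral_comp (hint _), Kernel.integral_comp (hint _)]
    change ENNReal.ofReal |∫ x, u x ∂_ - ∫ x, u x ∂_| ≤ _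
    rw [← (hD m).coupling.integral_sub hε hu z, abs_mul,
      abs_of_nonneg (survival_nonneg hε.2.le z), ENNReal.ofReal_mul (survival_nonneg hε.2.le z),
      ← Real.enorm_eq_ofReal_abs]
    refine mul_le_mul_right ((enorm_integral_le_lintegral_enorm _).trans
      (lintegral_mono fun y => ?_)) _
    rw [Real.enorm_eq_ofReal_abs]
    exact ih (m + 1) y

theorem tsum_weight_mul_abs_sub_le [∀ k, IsMarkovKernel (P k)]
    (hD : ∀ k, DriftStep φ c ε bV cV C V (P (k + 1)) (ν (k + 1)) (L (k + 1)))
    (hC : MeasurableSet C) (hB : 0 ≤ (bV + cV) / (1 - ε) - 1)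
    (hd : Tendsto (deriv φ) atTop (nhds 0)) {π : Measure X} [IsProbabilityMeasure π]
    (hπ : ∀ k, π.bind (P (k + 1)) = π) (hπV : Integrable V π) {f : X → ℝ} (hf : Measurable f)
    {K : ℝ} (hK : 0 ≤ K) {b : ℕ → ℝ} (hb : ∀ n, 0 < b n)
    (hfb : ∀ n x, b n * |f x| ≤ K * (rate φ c n + φ (V x) / φ 1)) (x : X) :
    ∑' n, ENNReal.ofReal (b n * |∫ y, f y ∂iterKernel P n x - ∫ y, f y ∂π|) ≤
      ENNReal.ofReal (cconst φ c ε bV cV * (V x + ∫ y, V y ∂π - 1) * K) := by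
  have hφ := (hD 0).driftFun
  have hV1 := (hD 0).one_le_V
  have h1 := hφ.pos 1 le_rfl
  obtain ⟨a₁, a₂, hle⟩ : ∃ a₁ a₂ : ℝ, ∀ x, |f x| ≤ a₁ + a₂ * V x := by
    refine ⟨K / b 0 * (2 - deriv φ 1 / φ 1), K / b 0 * (deriv φ 1 / φ 1), fun x => ?_⟩
    have ht := hφ.le_tangent le_rfl (hV1 x)
    have h2 : φ (V x) / φ 1 ≤ 1 + deriv φ 1 / φ 1 * (V x - 1) := by
      rw [div_le_iff₀ h1]
      field_simp
      linarith
    have h3 := hfb 0 x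
    rw [hφ.rate_zero] at h3
    have h4 : |f x| ≤ K / b 0 * (1 + φ (V x) / φ 1) := by
      rw [div_mul_eq_mul_div, le_div_iff₀ (hb 0)]
      linarith
    have h5 := mul_le_mul_of_nonneg_left h2 (div_nonneg hK (hb 0).le)
    linarith
  set u : ℕ → X → ℝ := fun n x => ∫ y, f y ∂iterKernel P n x with hu
  have hum : ∀ n, Measurable (u n) := fun n =>
    hf.stronglyMeasurable.integral_kernel.measurable
  have hfπ : Integrable f π := integrable_of_abs_le_add_mul hπV hf hle
  have hfn : ∀ n, Integrable f (iterKernel P n ∘ₘ π) := fun n => by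
    rwa [bind_iterKernel hπ n]
  have huπ : ∀ n, Integrable (u n) π := fun n => by
    have h := hfn n
    rw [Measure.comp_eq_comp_const_apply] at h
    simpa using h.integral_comp
  have hueq : ∀ n, ∫ x', u n x' ∂π = ∫ y, f y ∂π := fun n => by
    have h := hfn n
    rw [Measure.comp_eq_comp_const_apply] at h
    have := Kernel.integral_comp h
    rw [← Measure.comp_eq_comp_const_apply, bind_iterKernel hπ n] at this
    simpa using this.symm
  have hterm : ∀ n, ENNReal.ofReal (b n * |u n x - ∫ y, f y ∂π|) ≤
      ∫⁻ x', ENNReal.ofReal (b n) * ENNReal.ofReal |u n x - u n x'| ∂π := fun n => by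
    have : u n x - ∫ y, f y ∂π = ∫ x', (u n x - u n x') ∂π := by
      rw [integral_sub (integrable_const _) (huπ n), hueq]
      simp
    rw [ENNReal.ofReal_mul (hb n).le, lintegral_const_mul _
      (((hum n).const_sub _).abs.ennreal_ofReal), this, ← Real.enorm_eq_ofReal_abs]
    simp_rw [← Real.enorm_eq_ofReal_abs]
    exact mul_le_mul_right (enorm_integral_le_lintegral_enorm _) _
  have hpair : ∀ N x', ∑ n ∈ Finset.range N,
      ENNReal.ofReal (b n) * ENNReal.ofReal |u n x - u n x'| ≤
        ENNReal.ofReal (K * (cconst φ c ε bV cV * pairV V (x, x'))) := fun N x' => by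
    have hm : Measurable fun z : X × X => ENNReal.ofReal (|f z.1| + |f z.2|) :=
      ((hf.comp measurable_fst).abs.add (hf.comp measurable_snd).abs).ennreal_ofReal
    calc _ ≤ ∑ n ∈ Finset.range N, ENNReal.ofReal (b (0 + n)) * survIter (survival C ε) L
          (fun z => ENNReal.ofReal (|f z.1| + |f z.2|)) n 0 (x, x') := by
          refine Finset.sum_le_sum fun n _ => ?_
          have := ofReal_abs_integral_sub_le_survIter hD hf hle n 0 (x, x')
          simp only [zero_add] at this ⊢
          gcongr
      _ = accum (survival C ε) L
          (fun k z => ENNReal.ofReal (b k) * ENNReal.ofReal (|f z.1| + |f z.2|)) N 0 (x, x') :=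
          sum_survIter (measurable_survival hC ε) hm (fun n => ENNReal.ofReal (b n)) N 0 (x, x')
      _ ≤ ENNReal.ofReal K * costSum φ c ε C V L N 0 (x, x') := by
          refine accum_le_mul ENNReal.ofReal_ne_top (fun k z => ?_) N 0 (x, x')
          rw [← ENNReal.ofReal_mul (hb k).le, ← ENNReal.ofReal_mul hK]
          refine ENNReal.ofReal_le_ofReal ?_
          have e1 := hfb k z.1
          have e2 := hfb k z.2
          rw [add_div]
          linarith
      _ ≤ _ := by
          rw [ENNReal.ofReal_mul hK]
          gcongr
          exact costSum_zero_le hD hB hd N (x, x')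
  refine ENNReal.tsum_le_of_sum_range_le fun N => ?_
  have hcc : 0 ≤ cconst φ c ε bV cV :=
    cconst_nonneg hφ (hD 0).rate_mem.1 (hD 0).minor_mem (hD 0).bV_pos.le hB
  have hiV : Integrable (fun x' => K * (cconst φ c ε bV cV * pairV V (x, x'))) π :=
    (((((integrable_const (V x)).add hπV).sub (integrable_const 1)).const_mul _).const_mul K)
  calc _ ≤ ∑ n ∈ Finset.range N,
        ∫⁻ x', ENNReal.ofReal (b n) * ENNReal.ofReal |u n x - u n x'| ∂π :=
        Finset.sum_le_sum fun n _ => hterm n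
    _ = ∫⁻ x', ∑ n ∈ Finset.range N,
        ENNReal.ofReal (b n) * ENNReal.ofReal |u n x - u n x'| ∂π :=
        (lintegral_finsetSum _ fun n _ =>
          (((hum n).const_sub _).abs.ennreal_ofReal).const_mul _).symm
    _ ≤ ∫⁻ x', ENNReal.ofReal (K * (cconst φ c ε bV cV * pairV V (x, x'))) ∂π :=
        lintegral_mono fun x' => hpair N x'
    _ = ENNReal.ofReal (∫ x', K * (cconst φ c ε bV cV * pairV V (x, x')) ∂π) :=
        (ofReal_integral_eq_lintegral_ofReal hiV (Eventually.of_forall fun x' =>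
          mul_nonneg hK (mul_nonneg hcc (zero_le_one.trans (one_le_pairV hV1 _))))).symm
    _ = _ := by
        congr 1
        simp only [pairV]
        have hi1 : Integrable (fun x' => V x + V x') π := (integrable_const (V x)).add hπV
        rw [integral_const_mul, integral_const_mul, integral_sub hi1 (integrable_const 1),
          integral_add (integrable_const _) hπV]
        simp only [integral_const, probReal_univ, smul_eq_mul, one_mul]
        ring

end Convergence

/-- Remark 2.4(v): convergence to the invariant measure. -/
theorem statement3 {X : Type*} [MeasurableSpace X]
    (P : ℕ → Kernel X X) (hP : ∀ k, IsMarkovKernel (P k))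
    (C : Set X) (hC : MeasurableSet C)
    (V : X → ℝ) (hVmeas : Measurable V) (hV1 : ∀ x, 1 ≤ V x)
    (φ : ℝ → ℝ)
    (hφconc : ConcaveOn ℝ (Set.Ici 1) φ)
    (hφmono : MonotoneOn φ (Set.Ici 1))
    (hφdiff : ∀ t, 1 ≤ t → DifferentiableAt ℝ φ t)
    (hφpos : ∀ t, 1 ≤ t → 0 < φ t)
    (hφderiv0 : Tendsto (deriv φ) atTop (nhds 0))
    (ν : ℕ → Measure X) (hν : ∀ k, IsProbabilityMeasure (ν k))
    (εν εb : ℝ) (hεν : εν ∈ Set.Ioo (0:ℝ) 1) (hεb : εb ∈ Set.Ioo (0:ℝ) 1)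
    (bV cV : ℝ)
    (hVint : ∀ k, 1 ≤ k → ∀ x, Integrable V (P k x))
    (hdrift : ∀ k, 1 ≤ k → ∀ x,
      ∫ y, V y ∂(P k x) ≤ V x - φ (V x) + bV * C.indicator 1 x)
    (hminor : ∀ k, 1 ≤ k → ∀ x ∈ C, ∀ A : Set X, MeasurableSet A →
      ENNReal.ofReal εν * ν k A ≤ P k x A)
    (hout : ∀ x ∉ C, bV / (1 - εb) ≤ φ (V x))
    (hin : ∀ x ∈ C, V x ≤ cV)
    (π : Measure X) (hπ : IsProbabilityMeasure π)
    (hπinv : ∀ k, 1 ≤ k → π.bind (P k) = π)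
    (hπV : Integrable V π)
    (Ψ₁ Ψ₂ : ℝ → ℝ)
    (hΨ₁mono : MonotoneOn Ψ₁ (Set.Ici 1)) (hΨ₂mono : MonotoneOn Ψ₂ (Set.Ici 1))
    (hΨ₁pos : ∀ t, 1 ≤ t → 0 < Ψ₁ t) (hΨ₂pos : ∀ t, 1 ≤ t → 0 < Ψ₂ t)
    (hYoung : ∀ x y : ℝ, 1 ≤ x → 1 ≤ y → Ψ₁ x * Ψ₂ y ≤ x + y)
    (f : X → ℝ) (hfmeas : Measurable f)
    (Mf : ℝ) (hfW : ∀ x, |f x| ≤ Mf * Ψ₂ (φ (V x) / φ 1)) :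
    ∀ x : X,
      ∑' n : ℕ, ENNReal.ofReal (Ψ₁ (rate φ εb n) *
          |(∫ y, f y ∂(iterKernel P n x)) - ∫ y, f y ∂π|) ≤
        ENNReal.ofReal (cconst φ εb εν bV cV * (V x + (∫ y, V y ∂π) - 1) * Mf) := by
  intro x
  have hdf : IsDriftFun φ := ⟨hφconc, hφmono, hφdiff, hφpos⟩
  have hφ1 := hφpos 1 le_rfl
  have hy : ∀ x, 1 ≤ φ (V x) / φ 1 := fun x => by
    rw [one_le_div hφ1]
    exact hφmono (Set.mem_Ici.2 le_rfl) (Set.mem_Ici.2 (hV1 x)) (hV1 x)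
  have hVP : ∫ x, ∫ y, V y ∂P 1 x ∂π = ∫ y, V y ∂π ∧ Integrable (fun x => ∫ y, V y ∂P 1 x) π := by
    have h : Integrable V (P 1 ∘ₘ π) := by rwa [hπinv 1 le_rfl]
    rw [Measure.comp_eq_comp_const_apply] at h
    have hc := Kernel.integral_comp h
    rw [← Measure.comp_eq_comp_const_apply, hπinv 1 le_rfl] at hc
    exact ⟨by simpa using hc.symm, by simpa using h.integral_comp⟩
  have hpos : ∃ x, 0 < bV * C.indicator (1 : X → ℝ) x := by
    by_contra! hle
    have : ∫ x, ∫ y, V y ∂P 1 x ∂π ≤ ∫ x, (V x - φ 1) ∂π := by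
      refine integral_mono hVP.2 (hπV.sub (integrable_const _)) fun x => ?_
      have h1 := hdrift 1 le_rfl x
      have h2 := hφmono (Set.mem_Ici.2 le_rfl) (Set.mem_Ici.2 (hV1 x)) (hV1 x)
      have h3 := hle x
      simp only
      linarith
    rw [hVP.1, integral_sub hπV (integrable_const _)] at this
    simp only [integral_const, probReal_univ, smul_eq_mul, one_mul] at this
    linarith
  obtain ⟨x₀, hx₀⟩ := hpos
  have hx₀C : x₀ ∈ C := by
    by_contra h
    simp [h] at hx₀
  have hbV : 0 < bV := by simpa [hx₀C] using hx₀
  have hB : 0 ≤ (bV + cV) / (1 - εν) - 1 := by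
    have := (hV1 x₀).trans (hin x₀ hx₀C)
    rw [sub_nonneg, one_le_div (by linarith [hεν.2])]
    linarith [hεν.1]
  choose L hLm hL using fun k => exists_couplingKernel hC hεν (P (k + 1)) (ν (k + 1))
    (hminor (k + 1) (by omega))
  have hD : ∀ k, DriftStep φ εb εν bV cV C V (P (k + 1)) (ν (k + 1))
      (L (k + 1 - 1)) := fun k =>
    { driftFun := hdf
      rate_mem := hεb
      minor_mem := hεν
      bV_pos := hbV
      measurable_V := hVmeas
      one_le_V := hV1
      integrable_V := hVint (k + 1) (by omega)
      drift := hdrift (k + 1) (by omega)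
      outside := fun x hx => by
        have := hout x hx
        rwa [div_le_iff₀ (by linarith [hεb.2]), mul_comm] at this
      inside := hin
      prob_ν := hν (k + 1)
      markov_L := hLm k
      coupling := hL k }
  have hMf : 0 ≤ Mf := nonneg_of_mul_nonneg_left ((abs_nonneg _).trans (hfW x)) (hΨ₂pos _ (hy x))
  have hr := hdf.one_le_rate hεb.1.le
  refine tsum_weight_mul_abs_sub_le (ν := ν) (L := fun k => L (k - 1)) hD hC hB hφderiv0
    (fun k => hπinv (k + 1) (by omega)) hπV hfmeas hMf (fun n => hΨ₁pos _ (hr n)) (fun n y => ?_) x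
  calc _ ≤ Ψ₁ (rate φ εb n) * (Mf * Ψ₂ (φ (V y) / φ 1)) :=
        mul_le_mul_of_nonneg_left (hfW y) (hΨ₁pos _ (hr n)).le
    _ = Mf * (Ψ₁ (rate φ εb n) * Ψ₂ (φ (V y) / φ 1)) := by ring
    _ ≤ _ := mul_le_mul_of_nonneg_left (hYoung _ _ (hr n) (hy y)) hMf
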